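/- arXiv:1306.4829 — 2 statements merged into one kernel-verified Lean document; each statement's English description precedes it below -/
import Mathlib

section
/- Let A be a weak bimonoid in a duoidal category (M,∘,I,•,J) in which idempotent morphisms split. Define ⊓^L_∘ := (ϖ•(A∘J)).(((ε.μ)∘J)•(A∘J)).ζ.((Δ.η)∘A∘J) : A∘J → A∘J (where ζ : (A•A)∘A∘J → (A∘A∘J)•(A∘J)), with fixed splitting ι^L_∘, π^L_∘ through an object L_∘. Set φ := (A•τ)∘J : (A•I)∘J → A∘J and φ′ := (ϖ•((A•I)∘J)).(((ε.μ)∘J)•((A•I)∘J)).ζ.(((Δ.η)•I)∘A∘J).(δ∘A∘J) : A∘J → (A•I)∘J. Then: (i) φ.φ′ = ⊓^L_∘ and φ′.φ = ⊓^L_•∘J; (ii) consequently π^L_∘.φ.(ι^L_•∘J) : L_•∘J → L_∘ is an isomorphism with inverse (π^L_•∘J).φ′.ι^L_∘; (iii) this isomorphism is a morphism of L_•-J bimodules, where L_∘ is an A-J bimodule via left A-action π^L_∘.(μ∘J).(A∘ι^L_∘) and right J-action π^L_∘.(A∘ϖ).(ι^L_∘∘J), made a left L_•-module by restriction along the monoid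 morphism ω : L_• → A, and L_•∘J carries the left L_•-action μ^{L_•}∘J and right J-action L_•∘ϖ. -/
open CategoryTheory

universe v u

/-- A (strict) duoidal category structure on a category `M`: two strict monoidal
structures `co` (the first monoidal product `∘` with unit `uI`) and `bu` (the second
monoidal product `•` with unit `uJ`), together with the structure morphisms
`dlI : I ⟶ I • I`, `pw : J ∘ J ⟶ J`, `tau : I ⟶ J` and the interchange law `zt`,
subject to the axioms of a duoidal category. -/
structure Duo (M : Type u) [Category.{v} M] where
  co : M → M → M
  coh : ∀ {X₁ Y₁ X₂ Y₂ : M}, (X₁ ⟶ Y₁) → (X₂ ⟶ Y₂) → (co X₁ X₂ ⟶ co Y₁ Y₂)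
  uI : M
  bu : M → M → M
  buh : ∀ {X₁ Y₁ X₂ Y₂ : M}, (X₁ ⟶ Y₁) → (X₂ ⟶ Y₂) → (bu X₁ X₂ ⟶ bu Y₁ Y₂)
  uJ : M
  coA : ∀ X Y Z, co (co X Y) Z = co X (co Y Z)
  coL : ∀ X, co uI X = X
  coR : ∀ X, co X uI = X
  buA : ∀ X Y Z, bu (bu X Y) Z = bu X (bu Y Z)
  buL : ∀ X, bu uJ X = X
  buR : ∀ X, bu X uJ = X
  coh_id : ∀ X Y, coh (𝟙 X) (𝟙 Y) = 𝟙 (co X Y)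
  coh_comp : ∀ {X₁ Y₁ Z₁ X₂ Y₂ Z₂ : M} (f₁ : X₁ ⟶ Y₁) (g₁ : Y₁ ⟶ Z₁) (f₂ : X₂ ⟶ Y₂)
    (g₂ : Y₂ ⟶ Z₂), coh (f₁ ≫ g₁) (f₂ ≫ g₂) = coh f₁ f₂ ≫ coh g₁ g₂
  buh_id : ∀ X Y, buh (𝟙 X) (𝟙 Y) = 𝟙 (bu X Y)
  buh_comp : ∀ {X₁ Y₁ Z₁ X₂ Y₂ Z₂ : M} (f₁ : X₁ ⟶ Y₁) (g₁ : Y₁ ⟶ Z₁) (f₂ : X₂ ⟶ Y₂)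
    (g₂ : Y₂ ⟶ Z₂), buh (f₁ ≫ g₁) (f₂ ≫ g₂) = buh f₁ f₂ ≫ buh g₁ g₂
  coh_assoc : ∀ {X₁ Y₁ X₂ Y₂ X₃ Y₃ : M} (f₁ : X₁ ⟶ Y₁) (f₂ : X₂ ⟶ Y₂) (f₃ : X₃ ⟶ Y₃),
    coh (coh f₁ f₂) f₃
      = eqToHom (coA X₁ X₂ X₃) ≫ coh f₁ (coh f₂ f₃) ≫ eqToHom (coA Y₁ Y₂ Y₃).symm
  coh_unitL : ∀ {X Y : M} (f : X ⟶ Y),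
    coh (𝟙 uI) f = eqToHom (coL X) ≫ f ≫ eqToHom (coL Y).symm
  coh_unitR : ∀ {X Y : M} (f : X ⟶ Y),
    coh f (𝟙 uI) = eqToHom (coR X) ≫ f ≫ eqToHom (coR Y).symm
  buh_assoc : ∀ {X₁ Y₁ X₂ Y₂ X₃ Y₃ : M} (f₁ : X₁ ⟶ Y₁) (f₂ : X₂ ⟶ Y₂) (f₃ : X₃ ⟶ Y₃),
    buh (buh f₁ f₂) f₃
      = eqToHom (buA X₁ X₂ X₃) ≫ buh f₁ (buh f₂ f₃) ≫ eqToHom (buA Y₁ Y₂ Y₃).symm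
  buh_unitL : ∀ {X Y : M} (f : X ⟶ Y),
    buh (𝟙 uJ) f = eqToHom (buL X) ≫ f ≫ eqToHom (buL Y).symm
  buh_unitR : ∀ {X Y : M} (f : X ⟶ Y),
    buh f (𝟙 uJ) = eqToHom (buR X) ≫ f ≫ eqToHom (buR Y).symm
  dlI : uI ⟶ bu uI uI
  pw : co uJ uJ ⟶ uJ
  tau : uI ⟶ uJ
  zt : ∀ A B C D : M, co (bu A B) (bu C D) ⟶ bu (co A C) (co B D)
  zt_nat : ∀ {A A' B B' C C' D D' : M} (f : A ⟶ A') (g : B ⟶ B') (h : C ⟶ C')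
    (k : D ⟶ D'),
    coh (buh f g) (buh h k) ≫ zt A' B' C' D' = zt A B C D ≫ buh (coh f h) (coh g k)
  pw_assoc : coh pw (𝟙 uJ) ≫ pw = eqToHom (coA uJ uJ uJ) ≫ coh (𝟙 uJ) pw ≫ pw
  pw_unitL : eqToHom (coL uJ).symm ≫ coh tau (𝟙 uJ) ≫ pw = 𝟙 uJ
  pw_unitR : eqToHom (coR uJ).symm ≫ coh (𝟙 uJ) tau ≫ pw = 𝟙 uJ
  dlI_coassoc : dlI ≫ buh dlI (𝟙 uI) ≫ eqToHom (buA uI uI uI) = dlI ≫ buh (𝟙 uI) dlI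
  dlI_counitL : dlI ≫ buh tau (𝟙 uI) ≫ eqToHom (buL uI) = 𝟙 uI
  dlI_counitR : dlI ≫ buh (𝟙 uI) tau ≫ eqToHom (buR uI) = 𝟙 uI
  zt_assoc1 : ∀ A B C D E F : M,
    coh (zt A B C D) (𝟙 (bu E F)) ≫ zt (co A C) (co B D) E F
      = eqToHom (coA (bu A B) (bu C D) (bu E F)) ≫ coh (𝟙 (bu A B)) (zt C D E F)
          ≫ zt A B (co C E) (co D F)
          ≫ eqToHom (show bu (co A (co C E)) (co B (co D F))
              = bu (co (co A C) E) (co (co B D) F) by simp [coA])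
  zt_assoc2 : ∀ A B C D E F : M,
    zt (bu A B) C (bu D E) F ≫ buh (zt A B D E) (𝟙 (co C F))
      = eqToHom (show co (bu (bu A B) C) (bu (bu D E) F)
            = co (bu A (bu B C)) (bu D (bu E F)) by simp [buA])
          ≫ zt A (bu B C) D (bu E F) ≫ buh (𝟙 (co A D)) (zt B C E F)
          ≫ eqToHom (buA (co A D) (co B E) (co C F)).symm
  zt_unitA : ∀ A B : M,
    eqToHom (coL (bu A B)).symm ≫ coh dlI (𝟙 (bu A B)) ≫ zt uI uI A B
      ≫ eqToHom (show bu (co uI A) (co uI B) = bu A B by simp [coL]) = 𝟙 (bu A B)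
  zt_unitB : ∀ A B : M,
    eqToHom (coR (bu A B)).symm ≫ coh (𝟙 (bu A B)) dlI ≫ zt A B uI uI
      ≫ eqToHom (show bu (co A uI) (co B uI) = bu A B by simp [coR]) = 𝟙 (bu A B)
  zt_unitC : ∀ A B : M,
    eqToHom (show co A B = co (bu uJ A) (bu uJ B) by simp [buL]) ≫ zt uJ A uJ B
      ≫ buh pw (𝟙 (co A B)) ≫ eqToHom (buL (co A B)) = 𝟙 (co A B)
  zt_unitD : ∀ A B : M,
    eqToHom (show co A B = co (bu A uJ) (bu B uJ) by simp [buR]) ≫ zt A uJ B uJ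
      ≫ buh (𝟙 (co A B)) pw ≫ eqToHom (buR (co A B)) = 𝟙 (co A B)

namespace Duo

variable {M : Type u} [Category.{v} M] (D : Duo M)

/-- Axiom (WB): the multiplication is comultiplicative. -/
def WBeq (A : M) (mu : D.co A A ⟶ A) (dl : A ⟶ D.bu A A) : Prop :=
  mu ≫ dl = D.coh dl dl ≫ D.zt A A A A ≫ D.buh mu mu

/-- Axiom (RRU). -/
def RRUeq (A : M) (mu : D.co A A ⟶ A) (eta : D.uI ⟶ A) (dl : A ⟶ D.bu A A) : Prop :=
  D.dlI ≫ D.buh (𝟙 D.uI) (eta ≫ dl)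
    ≫ eqToHom (show D.bu D.uI (D.bu A A) = D.bu (D.co (D.bu D.uI A) D.uI) A by
        simp [D.coR, D.buA])
    ≫ D.buh (D.coh (𝟙 (D.bu D.uI A)) D.dlI) (𝟙 A)
    ≫ D.buh (D.coh (𝟙 (D.bu D.uI A)) (D.buh (𝟙 D.uI) (eta ≫ dl))) (𝟙 A)
    ≫ eqToHom (show D.bu (D.co (D.bu D.uI A) (D.bu D.uI (D.bu A A))) A
        = D.bu (D.co (D.bu D.uI A) (D.bu (D.bu D.uI A) A)) A by simp [D.buA])
    ≫ D.buh (D.zt D.uI A (D.bu D.uI A) A) (𝟙 A)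
    ≫ eqToHom (show D.bu (D.bu (D.co D.uI (D.bu D.uI A)) (D.co A A)) A
        = D.bu (D.bu (D.bu D.uI A) (D.co A A)) A by simp [D.coL])
    ≫ D.buh (D.buh (𝟙 (D.bu D.uI A)) mu) (𝟙 A)
  = D.dlI ≫ D.buh (𝟙 D.uI) eta ≫ D.buh (𝟙 D.uI) dl
    ≫ eqToHom (show D.bu D.uI (D.bu A A) = D.bu (D.bu D.uI A) A by simp [D.buA])
    ≫ D.buh (𝟙 (D.bu D.uI A)) dl
    ≫ eqToHom (show D.bu (D.bu D.uI A) (D.bu A A)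
        = D.bu (D.bu (D.bu D.uI A) A) A by simp [D.buA])

/-- Axiom (LRU). -/
def LRUeq (A : M) (mu : D.co A A ⟶ A) (eta : D.uI ⟶ A) (dl : A ⟶ D.bu A A) : Prop :=
  D.dlI ≫ D.buh (eta ≫ dl) (𝟙 D.uI)
    ≫ eqToHom (show D.bu (D.bu A A) D.uI = D.bu A (D.co (D.bu A D.uI) D.uI) by
        simp [D.coR, D.buA])
    ≫ D.buh (𝟙 A) (D.coh (𝟙 (D.bu A D.uI)) D.dlI)
    ≫ D.buh (𝟙 A) (D.coh (𝟙 (D.bu A D.uI)) (D.buh (eta ≫ dl) (𝟙 D.uI)))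
    ≫ eqToHom (show D.bu A (D.co (D.bu A D.uI) (D.bu (D.bu A A) D.uI))
        = D.bu A (D.co (D.bu A D.uI) (D.bu A (D.bu A D.uI))) by simp [D.buA])
    ≫ D.buh (𝟙 A) (D.zt A D.uI A (D.bu A D.uI))
    ≫ eqToHom (show D.bu A (D.bu (D.co A A) (D.co D.uI (D.bu A D.uI)))
        = D.bu (D.bu (D.bu A (D.co A A)) A) D.uI by simp [D.coL, D.buA])
    ≫ D.buh (D.buh (D.buh (𝟙 A) mu) (𝟙 A)) (𝟙 D.uI)
  = D.dlI ≫ D.buh eta (𝟙 D.uI) ≫ D.buh dl (𝟙 D.uI) ≫ D.buh (D.buh dl (𝟙 A)) (𝟙 D.uI)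

/-- Axiom (LRC). -/
def LRCeq (A : M) (mu : D.co A A ⟶ A) (dl : A ⟶ D.bu A A) (ep : A ⟶ D.uJ) : Prop :=
  D.coh (D.coh (𝟙 (D.co D.uJ A)) dl) (𝟙 A)
    ≫ eqToHom (show D.co (D.co (D.co D.uJ A) (D.bu A A)) A
        = D.co (D.co (D.bu (D.co D.uJ A) D.uJ) (D.bu A A)) A by simp [D.buR])
    ≫ D.coh (D.zt (D.co D.uJ A) D.uJ A A) (𝟙 A)
    ≫ D.coh (D.buh (eqToHom (D.coA D.uJ A A) ≫ D.coh (𝟙 D.uJ) (mu ≫ ep))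
        (𝟙 (D.co D.uJ A))) (𝟙 A)
    ≫ D.coh (D.buh D.pw (𝟙 (D.co D.uJ A))) (𝟙 A)
    ≫ eqToHom (show D.co (D.bu D.uJ (D.co D.uJ A)) A = D.co D.uJ (D.co A A) by
        simp [D.buL, D.coA])
    ≫ D.coh (𝟙 D.uJ) (mu ≫ ep) ≫ D.pw
  = eqToHom (show D.co (D.co (D.co D.uJ A) A) A = D.co (D.co D.uJ A) (D.co A A) by
        simp [D.coA])
    ≫ D.coh (𝟙 (D.co D.uJ A)) mu
    ≫ eqToHom (D.coA D.uJ A A)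
    ≫ D.coh (𝟙 D.uJ) mu ≫ D.coh (𝟙 D.uJ) ep ≫ D.pw

/-- Axiom (LLC). -/
def LLCeq (A : M) (mu : D.co A A ⟶ A) (dl : A ⟶ D.bu A A) (ep : A ⟶ D.uJ) : Prop :=
  D.coh (D.coh (𝟙 (D.co D.uJ A)) dl) (𝟙 A)
    ≫ eqToHom (show D.co (D.co (D.co D.uJ A) (D.bu A A)) A
        = D.co (D.co (D.bu D.uJ (D.co D.uJ A)) (D.bu A A)) A by simp [D.buL])
    ≫ D.coh (D.zt D.uJ (D.co D.uJ A) A A) (𝟙 A)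
    ≫ D.coh (D.buh (𝟙 (D.co D.uJ A))
        (eqToHom (D.coA D.uJ A A) ≫ D.coh (𝟙 D.uJ) (mu ≫ ep))) (𝟙 A)
    ≫ D.coh (D.buh (𝟙 (D.co D.uJ A)) D.pw) (𝟙 A)
    ≫ eqToHom (show D.co (D.bu (D.co D.uJ A) D.uJ) A = D.co D.uJ (D.co A A) by
        simp [D.buR, D.coA])
    ≫ D.coh (𝟙 D.uJ) (mu ≫ ep) ≫ D.pw
  = eqToHom (show D.co (D.co (D.co D.uJ A) A) A = D.co (D.co D.uJ A) (D.co A A) by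
        simp [D.coA])
    ≫ D.coh (𝟙 (D.co D.uJ A)) mu
    ≫ eqToHom (D.coA D.uJ A A)
    ≫ D.coh (𝟙 D.uJ) mu ≫ D.coh (𝟙 D.uJ) ep ≫ D.pw

/-- Axiom (RLU), obtained from (RRU) by replacing `∘` by its opposite. -/
def RLUeq (A : M) (mu : D.co A A ⟶ A) (eta : D.uI ⟶ A) (dl : A ⟶ D.bu A A) : Prop :=
  D.dlI ≫ D.buh (𝟙 D.uI) (eta ≫ dl)
    ≫ eqToHom (show D.bu D.uI (D.bu A A) = D.bu (D.co D.uI (D.bu D.uI A)) A by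
        simp [D.coL, D.buA])
    ≫ D.buh (D.coh D.dlI (𝟙 (D.bu D.uI A))) (𝟙 A)
    ≫ D.buh (D.coh (D.buh (𝟙 D.uI) (eta ≫ dl)) (𝟙 (D.bu D.uI A))) (𝟙 A)
    ≫ eqToHom (show D.bu (D.co (D.bu D.uI (D.bu A A)) (D.bu D.uI A)) A
        = D.bu (D.co (D.bu (D.bu D.uI A) A) (D.bu D.uI A)) A by simp [D.buA])
    ≫ D.buh (D.zt (D.bu D.uI A) A D.uI A) (𝟙 A)
    ≫ eqToHom (show D.bu (D.bu (D.co (D.bu D.uI A) D.uI) (D.co A A)) A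
        = D.bu (D.bu (D.bu D.uI A) (D.co A A)) A by simp [D.coR])
    ≫ D.buh (D.buh (𝟙 (D.bu D.uI A)) mu) (𝟙 A)
  = D.dlI ≫ D.buh (𝟙 D.uI) eta ≫ D.buh (𝟙 D.uI) dl
    ≫ eqToHom (show D.bu D.uI (D.bu A A) = D.bu (D.bu D.uI A) A by simp [D.buA])
    ≫ D.buh (𝟙 (D.bu D.uI A)) dl
    ≫ eqToHom (show D.bu (D.bu D.uI A) (D.bu A A)
        = D.bu (D.bu (D.bu D.uI A) A) A by simp [D.buA])

/-- Axiom (LLU), obtained from (LRU) by replacing `∘` by its opposite. -/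
def LLUeq (A : M) (mu : D.co A A ⟶ A) (eta : D.uI ⟶ A) (dl : A ⟶ D.bu A A) : Prop :=
  D.dlI ≫ D.buh (eta ≫ dl) (𝟙 D.uI)
    ≫ eqToHom (show D.bu (D.bu A A) D.uI = D.bu A (D.co D.uI (D.bu A D.uI)) by
        simp [D.coL, D.buA])
    ≫ D.buh (𝟙 A) (D.coh D.dlI (𝟙 (D.bu A D.uI)))
    ≫ D.buh (𝟙 A) (D.coh (D.buh (eta ≫ dl) (𝟙 D.uI)) (𝟙 (D.bu A D.uI)))
    ≫ eqToHom (show D.bu A (D.co (D.bu (D.bu A A) D.uI) (D.bu A D.uI))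
        = D.bu A (D.co (D.bu A (D.bu A D.uI)) (D.bu A D.uI)) by simp [D.buA])
    ≫ D.buh (𝟙 A) (D.zt A (D.bu A D.uI) A D.uI)
    ≫ eqToHom (show D.bu A (D.bu (D.co A A) (D.co (D.bu A D.uI) D.uI))
        = D.bu (D.bu (D.bu A (D.co A A)) A) D.uI by simp [D.coR, D.buA])
    ≫ D.buh (D.buh (D.buh (𝟙 A) mu) (𝟙 A)) (𝟙 D.uI)
  = D.dlI ≫ D.buh eta (𝟙 D.uI) ≫ D.buh dl (𝟙 D.uI) ≫ D.buh (D.buh dl (𝟙 A)) (𝟙 D.uI)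

/-- Axiom (RRC), obtained from (LLC) by replacing `∘` by its opposite. -/
def RRCeq (A : M) (mu : D.co A A ⟶ A) (dl : A ⟶ D.bu A A) (ep : A ⟶ D.uJ) : Prop :=
  D.coh (D.coh (D.coh (𝟙 A) dl) (𝟙 A)) (𝟙 D.uJ)
    ≫ eqToHom (show D.co (D.co (D.co A (D.bu A A)) A) D.uJ
        = D.co A (D.co (D.bu A A) (D.bu (D.co A D.uJ) D.uJ)) by simp [D.coA, D.buR])
    ≫ D.coh (𝟙 A) (D.zt A A (D.co A D.uJ) D.uJ)
    ≫ D.coh (𝟙 A) (D.buh (eqToHom (D.coA A A D.uJ).symm ≫ D.coh (mu ≫ ep) (𝟙 D.uJ))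
        (𝟙 (D.co A D.uJ)))
    ≫ D.coh (𝟙 A) (D.buh D.pw (𝟙 (D.co A D.uJ)))
    ≫ eqToHom (show D.co A (D.bu D.uJ (D.co A D.uJ)) = D.co (D.co A A) D.uJ by
        simp [D.buL, D.coA])
    ≫ D.coh (mu ≫ ep) (𝟙 D.uJ) ≫ D.pw
  = D.coh (D.coh mu (𝟙 A)) (𝟙 D.uJ) ≫ D.coh mu (𝟙 D.uJ) ≫ D.coh ep (𝟙 D.uJ) ≫ D.pw

/-- Axiom (RLC), obtained from (LRC) by replacing `∘` by its opposite. -/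
def RLCeq (A : M) (mu : D.co A A ⟶ A) (dl : A ⟶ D.bu A A) (ep : A ⟶ D.uJ) : Prop :=
  D.coh (D.coh (D.coh (𝟙 A) dl) (𝟙 A)) (𝟙 D.uJ)
    ≫ eqToHom (show D.co (D.co (D.co A (D.bu A A)) A) D.uJ
        = D.co A (D.co (D.bu A A) (D.bu D.uJ (D.co A D.uJ))) by simp [D.coA, D.buL])
    ≫ D.coh (𝟙 A) (D.zt A A D.uJ (D.co A D.uJ))
    ≫ D.coh (𝟙 A) (D.buh (𝟙 (D.co A D.uJ))
        (eqToHom (D.coA A A D.uJ).symm ≫ D.coh (mu ≫ ep) (𝟙 D.uJ)))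
    ≫ D.coh (𝟙 A) (D.buh (𝟙 (D.co A D.uJ)) D.pw)
    ≫ eqToHom (show D.co A (D.bu (D.co A D.uJ) D.uJ) = D.co (D.co A A) D.uJ by
        simp [D.buR, D.coA])
    ≫ D.coh (mu ≫ ep) (𝟙 D.uJ) ≫ D.pw
  = D.coh (D.coh mu (𝟙 A)) (𝟙 D.uJ) ≫ D.coh mu (𝟙 D.uJ) ≫ D.coh ep (𝟙 D.uJ) ≫ D.pw

end Duo

/-- A right weak bimonoid in a duoidal category. -/
structure RWB {M : Type u} [Category.{v} M] (D : Duo M) where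
  A : M
  mu : D.co A A ⟶ A
  eta : D.uI ⟶ A
  dl : A ⟶ D.bu A A
  ep : A ⟶ D.uJ
  mu_assoc : D.coh mu (𝟙 A) ≫ mu = eqToHom (D.coA A A A) ≫ D.coh (𝟙 A) mu ≫ mu
  mu_unitL : eqToHom (D.coL A).symm ≫ D.coh eta (𝟙 A) ≫ mu = 𝟙 A
  mu_unitR : eqToHom (D.coR A).symm ≫ D.coh (𝟙 A) eta ≫ mu = 𝟙 A
  dl_coassoc : dl ≫ D.buh dl (𝟙 A) ≫ eqToHom (D.buA A A A) = dl ≫ D.buh (𝟙 A) dl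
  dl_counitL : dl ≫ D.buh ep (𝟙 A) ≫ eqToHom (D.buL A) = 𝟙 A
  dl_counitR : dl ≫ D.buh (𝟙 A) ep ≫ eqToHom (D.buR A) = 𝟙 A
  wb : D.WBeq A mu dl
  rru : D.RRUeq A mu eta dl
  lru : D.LRUeq A mu eta dl
  lrc : D.LRCeq A mu dl ep
  llc : D.LLCeq A mu dl ep

/-- A weak bimonoid: both a right weak bimonoid and a left weak bimonoid. -/
structure WBim {M : Type u} [Category.{v} M] (D : Duo M) extends RWB D where
  rlu : D.RLUeq A mu eta dl
  llu : D.LLUeq A mu eta dl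
  rlc : D.RLCeq A mu dl ep
  rrc : D.RRCeq A mu dl ep

/-- Idempotent morphisms split in `M`. -/
def SplitIdem (M : Type u) [Category.{v} M] : Prop :=
  ∀ ⦃X : M⦄ (e : X ⟶ X), e ≫ e = e →
    ∃ (Y : M) (p : X ⟶ Y) (i : Y ⟶ X), p ≫ i = e ∧ i ≫ p = 𝟙 Y

namespace RWB

variable {M : Type u} [Category.{v} M] {D : Duo M} (W : RWB D)

/-- The object `J∘A`. -/
def JA : M := D.co D.uJ W.A

/-- The idempotent morphism `⊓^R_∘ :=
((J∘A)•ϖ).((J∘A)•(J∘(ε.μ))).ζ.(J∘A∘(Δ.η)) : J∘A ⟶ J∘A`. -/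
def sqcapR : W.JA ⟶ W.JA :=
  eqToHom (show W.JA = D.co W.JA D.uI by simp [D.coR])
    ≫ D.coh (𝟙 W.JA) (W.eta ≫ W.dl)
    ≫ eqToHom (show D.co W.JA (D.bu W.A W.A)
        = D.co (D.bu D.uJ W.JA) (D.bu W.A W.A) by simp [D.buL])
    ≫ D.zt D.uJ W.JA W.A W.A
    ≫ D.buh (𝟙 W.JA) (eqToHom (D.coA D.uJ W.A W.A) ≫ D.coh (𝟙 D.uJ) (W.mu ≫ W.ep))
    ≫ D.buh (𝟙 W.JA) D.pw
    ≫ eqToHom (D.buR W.JA)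

/-- The natural idempotent `χ^R_{F,G} = (φ•γ).ζ.((F•G)∘(Δ.η))` on `F•G`, for right
`A`-modules `(F,f)` and `(G,g)`. -/
def chiR (F G : M) (f : D.co F W.A ⟶ F) (g : D.co G W.A ⟶ G) :
    D.bu F G ⟶ D.bu F G :=
  eqToHom (show D.bu F G = D.co (D.bu F G) D.uI by simp [D.coR])
    ≫ D.coh (𝟙 (D.bu F G)) (W.eta ≫ W.dl)
    ≫ D.zt F G W.A W.A
    ≫ D.buh f g

/-- The morphism `J∘η : J ⟶ J∘A`. -/
def jeta : D.uJ ⟶ W.JA :=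
  eqToHom (D.coR D.uJ).symm ≫ D.coh (𝟙 D.uJ) W.eta

/-- The morphism `(π^R_∘).(τ∘A) : A ⟶ R_∘` needs `τ∘A : A ⟶ J∘A`. -/
def tauA : W.A ⟶ W.JA :=
  eqToHom (D.coL W.A).symm ≫ D.coh D.tau (𝟙 W.A)

section Retract

variable (R : M) (p : W.JA ⟶ R) (i : R ⟶ W.JA)

/-- The right `A`-action `γ_A = π^R_∘.(J∘μ).(ι^R_∘ ∘ A)` on the retract `R_∘`. -/
def gamA : D.co R W.A ⟶ R :=
  D.coh i (𝟙 W.A) ≫ eqToHom (D.coA D.uJ W.A W.A) ≫ D.coh (𝟙 D.uJ) W.mu ≫ p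

/-- The left `J`-action `γ_J = π^R_∘.(ϖ∘A).(J∘ι^R_∘)` on the retract `R_∘`. -/
def gamJ : D.co D.uJ R ⟶ R :=
  D.coh (𝟙 D.uJ) i ≫ eqToHom (D.coA D.uJ D.uJ W.A).symm ≫ D.coh D.pw (𝟙 W.A) ≫ p

/-- The multiplication `μ^R_∘ = (R∘•ϖ).(R∘•(J∘ε)).(R∘•ι^R_∘).χ^R_{R∘,R∘}`. -/
def muR : D.bu R R ⟶ R :=
  W.chiR R R (W.gamA R p i) (W.gamA R p i)
    ≫ D.buh (𝟙 R) i
    ≫ D.buh (𝟙 R) (D.coh (𝟙 D.uJ) W.ep)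
    ≫ D.buh (𝟙 R) D.pw
    ≫ eqToHom (D.buR R)

/-- The unit `η^R_∘ = π^R_∘.(J∘η)`. -/
def etaR : D.uJ ⟶ R := W.jeta ≫ p

/-- The comultiplication `Δ^R_∘ = χ^R_{R∘,R∘}.(R∘•π^R_∘).(R∘•(J∘η))`. -/
def DeltaR : R ⟶ D.bu R R :=
  eqToHom (D.buR R).symm
    ≫ D.buh (𝟙 R) W.jeta
    ≫ D.buh (𝟙 R) p
    ≫ W.chiR R R (W.gamA R p i) (W.gamA R p i)

/-- The counit `ε^R_∘ = ϖ.(J∘ε).ι^R_∘`. -/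
def epsR : R ⟶ D.uJ := i ≫ D.coh (𝟙 D.uJ) W.ep ≫ D.pw

end Retract

/-- The comultiplication-type morphism `ζ.(J∘Δ) : J∘A ⟶ (J∘A)•(J∘A)`. -/
def coact0 : W.JA ⟶ D.bu W.JA W.JA :=
  D.coh (𝟙 D.uJ) W.dl
    ≫ eqToHom (show D.co D.uJ (D.bu W.A W.A)
        = D.co (D.bu D.uJ D.uJ) (D.bu W.A W.A) by simp [D.buL])
    ≫ D.zt D.uJ D.uJ W.A W.A

end RWB

namespace RWB

variable {M : Type u} [Category.{v} M] {D : Duo M} (W : RWB D)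

/-- The object `A∘J`. -/
def AJ : M := D.co W.A D.uJ

/-- The object `A•I`. -/
def AI : M := D.bu W.A D.uI

/-- The idempotent `⊓^L_∘ := (ϖ•(A∘J)).(((ε.μ)∘J)•(A∘J)).ζ.((Δ.η)∘A∘J)` on `A∘J`. -/
def sqcapLo : W.AJ ⟶ W.AJ :=
  eqToHom (show W.AJ = D.co D.uI W.AJ by simp [D.coL])
    ≫ D.coh (W.eta ≫ W.dl) (𝟙 W.AJ)
    ≫ eqToHom (show D.co (D.bu W.A W.A) W.AJ
        = D.co (D.bu W.A W.A) (D.bu W.AJ D.uJ) by simp [D.buR])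
    ≫ D.zt W.A W.A W.AJ D.uJ
    ≫ D.buh (eqToHom (D.coA W.A W.A D.uJ).symm ≫ D.coh (W.mu ≫ W.ep) (𝟙 D.uJ) ≫ D.pw)
        (𝟙 W.AJ)
    ≫ eqToHom (D.buL W.AJ)

/-- The morphism `φ := (A•τ)∘J : (A•I)∘J ⟶ A∘J`. -/
def phiL : D.co W.AI D.uJ ⟶ W.AJ :=
  D.coh (D.buh (𝟙 W.A) D.tau ≫ eqToHom (D.buR W.A)) (𝟙 D.uJ)

/-- The morphism `φ′ : A∘J ⟶ (A•I)∘J`. -/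
def phiL' : W.AJ ⟶ D.co W.AI D.uJ :=
  eqToHom (show W.AJ = D.co D.uI W.AJ by simp [D.coL])
    ≫ D.coh D.dlI (𝟙 W.AJ)
    ≫ D.coh (D.buh (W.eta ≫ W.dl) (𝟙 D.uI)) (𝟙 W.AJ)
    ≫ eqToHom (show D.co (D.bu (D.bu W.A W.A) D.uI) W.AJ
        = D.co (D.bu W.A W.AI) (D.bu W.AJ D.uJ) by simp [AI, AJ, D.buA, D.buR])
    ≫ D.zt W.A W.AI W.AJ D.uJ
    ≫ D.buh (eqToHom (D.coA W.A W.A D.uJ).symm ≫ D.coh (W.mu ≫ W.ep) (𝟙 D.uJ) ≫ D.pw)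
        (𝟙 (D.co W.AI D.uJ))
    ≫ eqToHom (D.buL (D.co W.AI D.uJ))

/-- The idempotent `⊓^L_• := ((ε.μ)•(A•I)).ζ.((Δ.η•I)∘(A•I)).(δ∘(A•I))` on `A•I`. -/
def sqcapLbu : W.AI ⟶ W.AI :=
  eqToHom (show W.AI = D.co D.uI W.AI by simp [D.coL])
    ≫ D.coh D.dlI (𝟙 W.AI)
    ≫ D.coh (D.buh (W.eta ≫ W.dl) (𝟙 D.uI)) (𝟙 W.AI)
    ≫ eqToHom (show D.co (D.bu (D.bu W.A W.A) D.uI) W.AI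
        = D.co (D.bu W.A W.AI) (D.bu W.A D.uI) by simp [AI, D.buA])
    ≫ D.zt W.A W.AI W.A D.uI
    ≫ D.buh (W.mu ≫ W.ep) (eqToHom (D.coR W.AI))
    ≫ eqToHom (D.buL W.AI)

end RWB

/-- A morphism of `M` bundled with its domain and codomain. Equality of bundled
morphisms does not see identity morphisms of the form `eqToHom _`. -/
structure Mor (M : Type u) [Category.{v} M] where
  dom : M
  cod : M
  hom : dom ⟶ cod

namespace Mor

variable {M : Type u} [Category.{v} M]

/-- The bundled version of a morphism. -/
def of {X Y : M} (f : X ⟶ Y) : Mor M := ⟨X, Y, f⟩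

/-- The bundled identity morphism. -/
def one (X : M) : Mor M := of (𝟙 X)

open Classical in
/-- Total composition (in diagrammatic order) of bundled morphisms, equal to `f` if the
codomain of `f` differs from the domain of `g`. -/
noncomputable def comp (f g : Mor M) : Mor M :=
  if h : f.cod = g.dom then of (f.hom ≫ eqToHom h ≫ g.hom) else f

@[simp] lemma of_dom {X Y : M} (f : X ⟶ Y) : (of f).dom = X := (rfl)

@[simp] lemma of_cod {X Y : M} (f : X ⟶ Y) : (of f).cod = Y := (rfl)

@[simp] lemma one_dom (X : M) : (one X).dom = X := (rfl)

@[simp] lemma one_cod (X : M) : (one X).cod = X := (rfl)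

lemma of_injective {X Y : M} {f g : X ⟶ Y} (h : of f = of g) : f = g := by
  simpa [of] using h

lemma of_id (X : M) : of (𝟙 X) = one X := rfl

lemma of_comp {X Y Z : M} (f : X ⟶ Y) (g : Y ⟶ Z) : of (f ≫ g) = comp (of f) (of g) := by
  unfold comp of
  simp

lemma of_eqToHom {X Y : M} (h : X = Y) : of (eqToHom h) = one Y := by
  cases h; rfl

lemma of_conj {X X' Y Y' : M} (h : X' = X) (f : X ⟶ Y) (h' : Y = Y') :
    of (eqToHom h ≫ f ≫ eqToHom h') = of f := by
  cases h; cases h'; simp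

@[simp] lemma comp_dom (f g : Mor M) : (comp f g).dom = f.dom := by
  unfold comp; split <;> rfl

@[simp] lemma comp_cod (f g : Mor M) (h : f.cod = g.dom) : (comp f g).cod = g.cod := by
  simp [comp, h]

@[simp] lemma one_comp (X : M) (f : Mor M) (h : X = f.dom) : comp (one X) f = f := by
  subst h
  exact (of_comp (𝟙 _) f.hom).symm.trans (congrArg of (Category.id_comp f.hom))

@[simp] lemma comp_one (f : Mor M) (X : M) (h : f.cod = X) : comp f (one X) = f := by
  subst h
  exact (of_comp f.hom (𝟙 _)).symm.trans (congrArg of (Category.comp_id f.hom))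

@[simp] lemma comp_assoc (f g h : Mor M) (h₁ : f.cod = g.dom) (h₂ : g.cod = h.dom) :
    comp (comp f g) h = comp f (comp g h) := by
  obtain ⟨X, Y, f⟩ := f
  obtain ⟨Y', Z, g⟩ := g
  obtain ⟨Z', W, h⟩ := h
  dsimp at h₁ h₂
  subst h₁ h₂
  change comp (comp (of f) (of g)) (of h) = comp (of f) (comp (of g) (of h))
  simp only [← of_comp, Category.assoc]

end Mor

namespace Duo

open Mor

variable {M : Type u} [Category.{v} M] (D : Duo M)

/-- The product `∘` of bundled morphisms. -/
def mco (f g : Mor M) : Mor M := of (D.coh f.hom g.hom)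

/-- The product `•` of bundled morphisms. -/
def mbu (f g : Mor M) : Mor M := of (D.buh f.hom g.hom)

/-- The bundled interchange law. -/
def mzt (A B C E : M) : Mor M := of (D.zt A B C E)

lemma of_coh {X Y X' Y' : M} (f : X ⟶ Y) (g : X' ⟶ Y') :
    of (D.coh f g) = D.mco (of f) (of g) := rfl

lemma of_buh {X Y X' Y' : M} (f : X ⟶ Y) (g : X' ⟶ Y') :
    of (D.buh f g) = D.mbu (of f) (of g) := rfl

lemma of_zt (A B C E : M) : of (D.zt A B C E) = D.mzt A B C E := rfl

@[simp] lemma mco_dom (f g : Mor M) : (D.mco f g).dom = D.co f.dom g.dom := (rfl)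

@[simp] lemma mco_cod (f g : Mor M) : (D.mco f g).cod = D.co f.cod g.cod := (rfl)

@[simp] lemma mbu_dom (f g : Mor M) : (D.mbu f g).dom = D.bu f.dom g.dom := (rfl)

@[simp] lemma mbu_cod (f g : Mor M) : (D.mbu f g).cod = D.bu f.cod g.cod := (rfl)

@[simp] lemma mzt_dom (A B C E : M) :
    (D.mzt A B C E).dom = D.co (D.bu A B) (D.bu C E) := (rfl)

@[simp] lemma mzt_cod (A B C E : M) :
    (D.mzt A B C E).cod = D.bu (D.co A C) (D.co B E) := (rfl)

@[simp] lemma mco_one (X Y : M) : D.mco (one X) (one Y) = one (D.co X Y) :=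
  congrArg of (D.coh_id X Y)

@[simp] lemma mbu_one (X Y : M) : D.mbu (one X) (one Y) = one (D.bu X Y) :=
  congrArg of (D.buh_id X Y)

@[simp] lemma mco_assoc (f g h : Mor M) :
    D.mco (D.mco f g) h = D.mco f (D.mco g h) :=
  (congrArg of (D.coh_assoc f.hom g.hom h.hom)).trans (of_conj _ _ _)

@[simp] lemma mbu_assoc (f g h : Mor M) :
    D.mbu (D.mbu f g) h = D.mbu f (D.mbu g h) :=
  (congrArg of (D.buh_assoc f.hom g.hom h.hom)).trans (of_conj _ _ _)

@[simp] lemma mco_unitL (f : Mor M) : D.mco (one D.uI) f = f :=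
  (congrArg of (D.coh_unitL f.hom)).trans (of_conj _ _ _)

@[simp] lemma mco_unitR (f : Mor M) : D.mco f (one D.uI) = f :=
  (congrArg of (D.coh_unitR f.hom)).trans (of_conj _ _ _)

@[simp] lemma mbu_unitL (f : Mor M) : D.mbu (one D.uJ) f = f :=
  (congrArg of (D.buh_unitL f.hom)).trans (of_conj _ _ _)

@[simp] lemma mbu_unitR (f : Mor M) : D.mbu f (one D.uJ) = f :=
  (congrArg of (D.buh_unitR f.hom)).trans (of_conj _ _ _)

@[simp] lemma mco_one_mco_one (X Y : M) (f : Mor M) :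
    D.mco (one X) (D.mco (one Y) f) = D.mco (one (D.co X Y)) f := by
  rw [← mco_assoc, mco_one]

@[simp] lemma mbu_one_mbu_one (X Y : M) (f : Mor M) :
    D.mbu (one X) (D.mbu (one Y) f) = D.mbu (one (D.bu X Y)) f := by
  rw [← mbu_assoc, mbu_one]

lemma mco_comp (f g f' g' : Mor M) (h : f.cod = g.dom) (h' : f'.cod = g'.dom) :
    D.mco (comp f g) (comp f' g') = comp (D.mco f f') (D.mco g g') := by
  obtain ⟨X, Y, f⟩ := f
  obtain ⟨Y₁, Z, g⟩ := g
  obtain ⟨X', Y', f'⟩ := f'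
  obtain ⟨Y₁', Z', g'⟩ := g'
  dsimp at h h'
  subst h h'
  change D.mco (comp (of f) (of g)) (comp (of f') (of g'))
    = comp (D.mco (of f) (of f')) (D.mco (of g) (of g'))
  simp only [← of_comp, ← of_coh, D.coh_comp]

lemma mbu_comp (f g f' g' : Mor M) (h : f.cod = g.dom) (h' : f'.cod = g'.dom) :
    D.mbu (comp f g) (comp f' g') = comp (D.mbu f f') (D.mbu g g') := by
  obtain ⟨X, Y, f⟩ := f
  obtain ⟨Y₁, Z, g⟩ := g
  obtain ⟨X', Y', f'⟩ := f'
  obtain ⟨Y₁', Z', g'⟩ := g'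
  dsimp at h h'
  subst h h'
  change D.mbu (comp (of f) (of g)) (comp (of f') (of g'))
    = comp (D.mbu (of f) (of f')) (D.mbu (of g) (of g'))
  simp only [← of_comp, ← of_buh, D.buh_comp]

lemma mzt_nat (f g h k : Mor M) :
    comp (D.mco (D.mbu f g) (D.mbu h k)) (D.mzt f.cod g.cod h.cod k.cod)
      = comp (D.mzt f.dom g.dom h.dom k.dom) (D.mbu (D.mco f h) (D.mco g k)) := by
  have := congrArg of (D.zt_nat f.hom g.hom h.hom k.hom)
  rwa [of_comp, of_comp] at this

/-- Naturality of the interchange law, applied after arbitrary morphisms. -/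
lemma comp_mzt_nat (x y f g h k : Mor M) (hx : x.cod = D.bu f.dom g.dom)
    (hy : y.cod = D.bu h.dom k.dom) :
    comp (D.mco (comp x (D.mbu f g)) (comp y (D.mbu h k))) (D.mzt f.cod g.cod h.cod k.cod)
      = comp (D.mco x y)
        (comp (D.mzt f.dom g.dom h.dom k.dom) (D.mbu (D.mco f h) (D.mco g k))) := by
  rw [D.mco_comp _ _ _ _ hx hy, comp_assoc, mzt_nat] <;> simp [hx, hy]

lemma mzt_assoc (A B C E F G : M) :
    comp (D.mco (D.mzt A B C E) (one (D.bu F G))) (D.mzt (D.co A C) (D.co B E) F G)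
      = comp (D.mco (one (D.bu A B)) (D.mzt C E F G))
          (D.mzt A B (D.co C F) (D.co E G)) := by
  have := congrArg of (D.zt_assoc1 A B C E F G)
  simpa [of_comp, of_coh, of_id, of_eqToHom, of_zt, D.coA] using this

lemma mzt_pwL (A B : M) :
    comp (D.mzt D.uJ A D.uJ B) (D.mbu (of D.pw) (one (D.co A B))) = one (D.co A B) := by
  have := congrArg of (D.zt_unitC A B)
  simpa [of_comp, of_buh, of_id, of_eqToHom, of_zt, D.coA, D.buL, D.buR] using this

lemma mzt_pwR (A B : M) :
    comp (D.mzt A D.uJ B D.uJ) (D.mbu (one (D.co A B)) (of D.pw)) = one (D.co A B) := by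
  have := congrArg of (D.zt_unitD A B)
  simpa [of_comp, of_buh, of_id, of_eqToHom, of_zt, D.coA, D.buL, D.buR] using this

lemma dlI_tauR : comp (of D.dlI) (D.mbu (one D.uI) (of D.tau)) = one D.uI := by
  have := congrArg of D.dlI_counitR
  simpa [of_comp, of_buh, of_id, of_eqToHom, of_zt, D.coA, D.buL, D.buR] using this

lemma tau_pw : comp (D.mco (of D.tau) (one D.uJ)) (of D.pw) = one D.uJ := by
  have := congrArg of D.pw_unitL
  simpa [of_comp, of_coh, of_id, of_eqToHom, of_zt, D.coA, D.coL, D.buR] using this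

/-- The morphism `(A•τ)∘J` is an instance of the interchange law. -/
lemma mco_mbu_tau (A : M) :
    D.mco (D.mbu (one A) (of D.tau)) (one D.uJ) = D.mzt A D.uI D.uJ D.uJ := by
  have h₁ := D.mzt_nat (one A) (of D.tau) (one D.uJ) (one D.uJ)
  have h₂ := congrArg (fun f => comp f (D.mbu (one (D.co A D.uJ)) (of D.pw))) h₁
  have h₃ := D.mbu_comp (one (D.co A D.uJ)) (one (D.co A D.uJ))
    (D.mco (of D.tau) (one D.uJ)) (of D.pw) (by simp) (by simp)
  simp [D.buL, D.buR, D.coL, mzt_pwR, ← h₃, tau_pw] at h₂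
  exact h₂

end Duo

namespace RWB

open Mor

variable {M : Type u} [Category.{v} M] {D : Duo M} (W : RWB D)

attribute [local simp] Duo.coA Duo.coL Duo.coR Duo.buA Duo.buL Duo.buR

/-- The bundled morphism `((Δ.η)•I).δ : I ⟶ A•A•I`. -/
noncomputable def unitCopair : Mor M :=
  comp (of D.dlI) (D.mbu (comp (of W.eta) (of W.dl)) (one D.uI))

/-- The bundled morphism `A•τ : A•I ⟶ A`. -/
def counitAI : Mor M := D.mbu (one W.A) (of D.tau)

/-- The bundled morphism `ϖ.((ε.μ)∘J) : A∘A∘J ⟶ J`. -/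
noncomputable def pairJ : Mor M :=
  comp (D.mco (comp (of W.mu) (of W.ep)) (one D.uJ)) (of D.pw)

/-- Multiplication of the first factor of `A•I` by `Δ.η` on the left,
as a bundled morphism `A•I ⟶ A•(A•I)`. -/
noncomputable def mulCopairL : Mor M :=
  comp (D.mco W.unitCopair (one (D.bu W.A D.uI)))
    (comp (D.mzt W.A (D.bu W.A D.uI) W.A D.uI) (D.mbu (of W.mu) (one (D.bu W.A D.uI))))

/-- Multiplication of the first factor of `A•I` by `Δ.η` on the right,
as a bundled morphism `A•I ⟶ A•(A•I)`. -/
noncomputable def mulCopairR : Mor M :=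
  comp (D.mco (one (D.bu W.A D.uI)) W.unitCopair)
    (comp (D.mzt W.A D.uI W.A (D.bu W.A D.uI)) (D.mbu (of W.mu) (one (D.bu W.A D.uI))))

@[simp] lemma unitCopair_dom : W.unitCopair.dom = D.uI := by simp [unitCopair]

@[simp] lemma unitCopair_cod : W.unitCopair.cod = D.bu W.A (D.bu W.A D.uI) := by
  simp [unitCopair, D.buA]

@[simp] lemma counitAI_dom : W.counitAI.dom = D.bu W.A D.uI := by simp [counitAI]

@[simp] lemma counitAI_cod : W.counitAI.cod = W.A := by simp [counitAI, D.buR]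

@[simp] lemma pairJ_dom : W.pairJ.dom = D.co W.A (D.co W.A D.uJ) := by
  simp [pairJ, D.coA]

@[simp] lemma pairJ_cod : W.pairJ.cod = D.uJ := by simp [pairJ]

@[simp] lemma mulCopairL_dom : W.mulCopairL.dom = D.bu W.A D.uI := by
  simp [mulCopairL, D.coL]

@[simp] lemma mulCopairL_cod : W.mulCopairL.cod = D.bu W.A (D.bu W.A D.uI) := by
  simp [mulCopairL, D.coR]

@[simp] lemma mulCopairR_dom : W.mulCopairR.dom = D.bu W.A D.uI := by
  simp [mulCopairR, D.coR]

@[simp] lemma mulCopairR_cod : W.mulCopairR.cod = D.bu W.A (D.bu W.A D.uI) := by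
  simp [mulCopairR, D.coL]

lemma of_phiL : of W.phiL = D.mco W.counitAI (one D.uJ) := by
  change of (D.coh (D.buh (𝟙 W.A) D.tau ≫ eqToHom (D.buR W.A)) (𝟙 D.uJ)) = _
  simp [counitAI, of_comp, D.of_coh, D.of_buh, of_id, of_eqToHom, D.buR]

lemma mco_unitCopair_one (X : M) : D.mco W.unitCopair (one X)
    = comp (D.mco (of D.dlI) (one X))
        (D.mco (D.mbu (comp (of W.eta) (of W.dl)) (one D.uI)) (one X)) := by
  rw [unitCopair, ← D.mco_comp _ _ _ _ (by simp) (by simp), comp_one _ _ (by simp)]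

lemma of_sqcapLo : of W.sqcapLo
    = comp (D.mco (comp (of W.eta) (of W.dl)) (one (D.co W.A D.uJ)))
        (comp (D.mzt W.A W.A (D.co W.A D.uJ) D.uJ)
          (D.mbu W.pairJ (one (D.co W.A D.uJ)))) := by
  change of (eqToHom (D.coL (D.co W.A D.uJ)).symm
    ≫ D.coh (W.eta ≫ W.dl) (𝟙 (D.co W.A D.uJ))
    ≫ eqToHom (show D.co (D.bu W.A W.A) (D.co W.A D.uJ)
        = D.co (D.bu W.A W.A) (D.bu (D.co W.A D.uJ) D.uJ) by simp [D.buR])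
    ≫ D.zt W.A W.A (D.co W.A D.uJ) D.uJ
    ≫ D.buh (eqToHom (D.coA W.A W.A D.uJ).symm ≫ D.coh (W.mu ≫ W.ep) (𝟙 D.uJ) ≫ D.pw)
        (𝟙 (D.co W.A D.uJ))
    ≫ eqToHom (D.buL (D.co W.A D.uJ))) = _
  simp only [of_comp, D.of_coh, D.of_buh, D.of_zt, of_id, of_eqToHom]
  have h : comp (D.mco (comp (of W.mu) (of W.ep)) (one D.uJ)) (of D.pw) = W.pairJ := rfl
  simp [h]

lemma of_phiL' : of W.phiL'
    = comp (D.mco W.unitCopair (one (D.co W.A D.uJ)))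
        (comp (D.mzt W.A (D.bu W.A D.uI) (D.co W.A D.uJ) D.uJ)
          (D.mbu W.pairJ (one (D.co (D.bu W.A D.uI) D.uJ)))) := by
  change of (eqToHom (D.coL (D.co W.A D.uJ)).symm
    ≫ D.coh D.dlI (𝟙 (D.co W.A D.uJ))
    ≫ D.coh (D.buh (W.eta ≫ W.dl) (𝟙 D.uI)) (𝟙 (D.co W.A D.uJ))
    ≫ eqToHom (show D.co (D.bu (D.bu W.A W.A) D.uI) (D.co W.A D.uJ)
        = D.co (D.bu W.A (D.bu W.A D.uI)) (D.bu (D.co W.A D.uJ) D.uJ) by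
          simp [D.buA, D.buR])
    ≫ D.zt W.A (D.bu W.A D.uI) (D.co W.A D.uJ) D.uJ
    ≫ D.buh (eqToHom (D.coA W.A W.A D.uJ).symm ≫ D.coh (W.mu ≫ W.ep) (𝟙 D.uJ) ≫ D.pw)
        (𝟙 (D.co (D.bu W.A D.uI) D.uJ))
    ≫ eqToHom (D.buL (D.co (D.bu W.A D.uI) D.uJ))) = _
  simp only [of_comp, D.of_coh, D.of_buh, D.of_zt, of_id, of_eqToHom]
  have h : comp (D.mco (comp (of W.mu) (of W.ep)) (one D.uJ)) (of D.pw) = W.pairJ := rfl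
  simp [mco_unitCopair_one, h]

lemma of_sqcapLbu : of W.sqcapLbu
    = comp (D.mco W.unitCopair (one (D.bu W.A D.uI)))
        (comp (D.mzt W.A (D.bu W.A D.uI) W.A D.uI)
          (D.mbu (comp (of W.mu) (of W.ep)) (one (D.bu W.A D.uI)))) := by
  change of (eqToHom (D.coL (D.bu W.A D.uI)).symm
    ≫ D.coh D.dlI (𝟙 (D.bu W.A D.uI))
    ≫ D.coh (D.buh (W.eta ≫ W.dl) (𝟙 D.uI)) (𝟙 (D.bu W.A D.uI))
    ≫ eqToHom (show D.co (D.bu (D.bu W.A W.A) D.uI) (D.bu W.A D.uI)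
        = D.co (D.bu W.A (D.bu W.A D.uI)) (D.bu W.A D.uI) by simp [D.buA])
    ≫ D.zt W.A (D.bu W.A D.uI) W.A D.uI
    ≫ D.buh (W.mu ≫ W.ep) (eqToHom (D.coR (D.bu W.A D.uI)))
    ≫ eqToHom (D.buL (D.bu W.A D.uI))) = _
  simp only [of_comp, D.of_coh, D.of_buh, D.of_zt, of_id, of_eqToHom]
  simp [mco_unitCopair_one, D.coL, D.buL, D.buA]

lemma unitCopair_comp_counitAI :
    comp W.unitCopair (D.mbu (one W.A) W.counitAI) = comp (of W.eta) (of W.dl) := by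
  have h := D.mbu_comp (comp (of W.eta) (of W.dl)) (one (D.bu W.A W.A)) (one D.uI) (of D.tau)
    (by simp) (by simp)
  have h' := D.mbu_comp (one D.uI) (comp (of W.eta) (of W.dl)) (of D.tau) (one D.uJ)
    (by simp) (by simp)
  simp at h h'
  have h₁ : D.mbu (one W.A) W.counitAI = D.mbu (one (D.bu W.A W.A)) (of D.tau) := by
    simp [counitAI]
  rw [unitCopair, h₁, comp_assoc _ _ _ (by simp) (by simp), ← h, h',
    ← comp_assoc _ _ _ (by simp) (by simp [D.buR]), D.dlI_tauR, one_comp _ _ (by simp)]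

theorem phiL'_comp_phiL : W.phiL' ≫ W.phiL = W.sqcapLo := by
  apply of_injective
  have h := D.comp_mzt_nat W.unitCopair (one (D.co W.A D.uJ)) (one W.A) W.counitAI
    (one (D.co W.A D.uJ)) (one D.uJ) (by simp) (by simp [D.buR])
  simp [W.unitCopair_comp_counitAI] at h
  have h₁ := D.mbu_comp W.pairJ (one D.uJ) (one (D.co (D.bu W.A D.uI) D.uJ))
    (D.mco W.counitAI (one D.uJ)) (by simp) (by simp)
  have h₂ := D.mbu_comp (one (D.co W.A (D.co W.A D.uJ))) W.pairJ
    (D.mco W.counitAI (one D.uJ)) (one (D.co W.A D.uJ)) (by simp) (by simp)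
  simp at h₁ h₂
  rw [of_comp, of_phiL', of_phiL, of_sqcapLo]
  rw [← comp_assoc (D.mco (comp _ _) _) _ _ (by simp [D.buR]) (by simp), h]
  simp [D.buR, ← h₁, h₂, D.buL]

lemma mzt_pairJ (X : M) :
    comp (D.mzt (D.co W.A W.A) X D.uJ D.uJ) (D.mbu W.pairJ (one (D.co X D.uJ)))
      = D.mco (D.mbu (comp (of W.mu) (of W.ep)) (one X)) (one D.uJ) := by
  have h₁ := D.mzt_nat (comp (of W.mu) (of W.ep)) (one X) (one D.uJ) (one D.uJ)
  have h₂ := D.mbu_comp (D.mco (comp (of W.mu) (of W.ep)) (one D.uJ)) (of D.pw)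
    (one (D.co X D.uJ)) (one (D.co X D.uJ)) (by simp) (by simp)
  have h₃ := D.mzt_pwL X D.uJ
  simp at h₁ h₂ h₃
  rw [pairJ, h₂, ← comp_assoc _ _ _ (by simp) (by simp), ← h₁,
    comp_assoc _ _ _ (by simp) (by simp), h₃, comp_one _ _ (by simp)]

theorem phiL_comp_phiL' : W.phiL ≫ W.phiL' = D.coh W.sqcapLbu (𝟙 D.uJ) := by
  apply of_injective
  have h₁ := D.mco_comp W.unitCopair (one (D.bu W.A (D.bu W.A D.uI)))
    (one (D.co (D.bu W.A D.uI) D.uJ)) (D.mzt W.A D.uI D.uJ D.uJ)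
    (by simp) (by simp)
  have h₂ := D.mco_comp (one D.uI) W.unitCopair
    (D.mzt W.A D.uI D.uJ D.uJ) (one (D.co W.A D.uJ))
    (by simp) (by simp)
  have h₃ := D.mzt_assoc W.A (D.bu W.A D.uI) W.A D.uI D.uJ D.uJ
  have h₄ := D.mco_comp (D.mco W.unitCopair (one (D.bu W.A D.uI))) (comp (D.mzt W.A (D.bu W.A D.uI) W.A D.uI)
    (D.mbu (comp (of W.mu) (of W.ep)) (one (D.bu W.A D.uI))))
    (one D.uJ) (one D.uJ) (by simp) (by simp)
  have h₅ := D.mco_comp (D.mzt W.A (D.bu W.A D.uI) W.A D.uI)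
    (D.mbu (comp (of W.mu) (of W.ep)) (one (D.bu W.A D.uI))) (one D.uJ) (one D.uJ)
  have h₆ := W.mzt_pairJ (D.bu W.A D.uI)
  rw [of_comp, of_phiL', of_phiL, D.of_coh, of_sqcapLbu, of_id, counitAI, D.mco_mbu_tau]
  simp at h₁ h₂ h₃ h₄ h₅ h₆
  rw [← comp_assoc _ _ _ (by simp) (by simp), ← h₂, h₁, comp_assoc _ _ _ (by simp) (by simp),
    ← comp_assoc (D.mco _ (D.mzt _ _ _ _)) _ _ (by simp) (by simp), ← h₃,
    comp_assoc _ _ _ (by simp) (by simp), h₆, ← h₅, ← h₄]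
lemma mul_assoc : comp (D.mco (of W.mu) (one W.A)) (of W.mu)
    = comp (D.mco (one W.A) (of W.mu)) (of W.mu) := by
  have := congrArg of W.mu_assoc
  simpa [of_comp, D.of_coh, of_id, of_eqToHom] using this

lemma unit_mul : comp (D.mco (of W.eta) (one W.A)) (of W.mu) = one W.A := by
  have := congrArg of W.mu_unitL
  simpa [of_comp, D.of_coh, of_id, of_eqToHom] using this

lemma comul_coassoc : comp (of W.dl) (D.mbu (of W.dl) (one W.A))
    = comp (of W.dl) (D.mbu (one W.A) (of W.dl)) := by
  have := congrArg of W.dl_coassoc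
  simpa [of_comp, D.of_buh, of_id, of_eqToHom] using this

lemma comul_counitL : comp (of W.dl) (D.mbu (of W.ep) (one W.A)) = one W.A := by
  have := congrArg of W.dl_counitL
  simpa [of_comp, D.of_buh, of_id, of_eqToHom] using this

lemma comul_counitR : comp (of W.dl) (D.mbu (one W.A) (of W.ep)) = one W.A := by
  have := congrArg of W.dl_counitR
  simpa [of_comp, D.of_buh, of_id, of_eqToHom] using this

lemma mul_comul : comp (of W.mu) (of W.dl)
    = comp (D.mco (of W.dl) (of W.dl))
        (comp (D.mzt W.A W.A W.A W.A) (D.mbu (of W.mu) (of W.mu))) := by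
  have := congrArg of W.wb
  simpa [of_comp, D.of_coh, D.of_buh, D.of_zt] using this

/-- Multiplying a comultiplied element by `Δ.η` on the left, in both factors. -/
lemma mco_unit_comul : comp (D.mco (comp (of W.eta) (of W.dl)) (of W.dl))
    (comp (D.mzt W.A W.A W.A W.A) (D.mbu (of W.mu) (of W.mu))) = of W.dl := by
  have h := D.mco_comp (of W.eta) (of W.dl) (one W.A) (of W.dl) (by simp) (by simp)
  simp at h
  rw [h, comp_assoc _ _ _ (by simp) (by simp), ← mul_comul,
    ← comp_assoc _ _ _ (by simp) (by simp), unit_mul, one_comp _ _ (by simp)]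

lemma unitCopair_coassoc :
    comp W.unitCopair (D.mbu (of W.dl) (one (D.bu W.A D.uI)))
      = comp W.unitCopair (D.mbu (one W.A) (D.mbu (of W.dl) (one D.uI))) := by
  have h₁ := D.mbu_comp (comp (of W.eta) (of W.dl)) (D.mbu (of W.dl) (one W.A)) (one D.uI)
    (one D.uI) (by simp) (by simp)
  have h₂ := D.mbu_comp (comp (of W.eta) (of W.dl)) (D.mbu (one W.A) (of W.dl)) (one D.uI)
    (one D.uI) (by simp) (by simp)
  simp [W.comul_coassoc] at h₁ h₂
  rw [unitCopair, comp_assoc _ _ _ (by simp) (by simp), comp_assoc _ _ _ (by simp) (by simp),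
    ← h₁, ← h₂]

lemma unitCopair_comul : comp W.unitCopair (D.mbu (one W.A) (D.mbu (of W.dl) (one D.uI)))
    = comp (of D.dlI) (comp (D.mbu (of W.eta) (one D.uI)) (comp (D.mbu (of W.dl) (one D.uI))
        (D.mbu (of W.dl) (one (D.bu W.A D.uI))))) := by
  have h := D.mbu_comp (of W.eta) (of W.dl) (one D.uI) (one D.uI) (by simp) (by simp)
  simp at h
  rw [← unitCopair_coassoc, unitCopair, h]
  simp

lemma unitCopair_mulCopairR : comp W.unitCopair (D.mbu (one W.A) W.mulCopairR)
    = comp W.unitCopair (D.mbu (one W.A) (D.mbu (of W.dl) (one D.uI))) := by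
  have h := congrArg of W.lru
  have h₁ := D.mco_comp (one (D.bu W.A D.uI)) (one (D.bu W.A D.uI)) (of D.dlI)
    (D.mbu (comp (of W.eta) (of W.dl)) (one D.uI)) (by simp) (by simp)
  have h₂ := D.mbu_comp (one W.A) (one W.A)
    (D.mco (one (D.bu W.A D.uI)) W.unitCopair)
    (comp (D.mzt W.A D.uI W.A (D.bu W.A D.uI)) (D.mbu (of W.mu) (one (D.bu W.A D.uI))))
    (by simp) (by simp)
  have h₃ := D.mbu_comp (one W.A) (one W.A) (D.mzt W.A D.uI W.A (D.bu W.A D.uI))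
    (D.mbu (of W.mu) (one (D.bu W.A D.uI))) (by simp) (by simp)
  have h₄ := D.mbu_comp (one W.A) (one W.A) (D.mco (one (D.bu W.A D.uI)) (of D.dlI))
    (D.mco (one (D.bu W.A D.uI)) (D.mbu (comp (of W.eta) (of W.dl)) (one D.uI)))
    (by simp) (by simp)
  simp at h₁ h₂ h₃ h₄
  rw [unitCopair_comul, mulCopairR, h₂, h₃]
  nth_rw 2 [unitCopair]
  rw [h₁, h₄, unitCopair]
  simp [of_comp, D.of_coh, D.of_buh, D.of_zt, of_id, of_eqToHom] at h
  simp [h]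

lemma unitCopair_mulCopairL (hllu : D.LLUeq W.A W.mu W.eta W.dl) :
    comp W.unitCopair (D.mbu (one W.A) W.mulCopairL)
      = comp W.unitCopair (D.mbu (one W.A) (D.mbu (of W.dl) (one D.uI))) := by
  have h := congrArg of hllu
  have h₁ := D.mco_comp (of D.dlI)
    (D.mbu (comp (of W.eta) (of W.dl)) (one D.uI)) (one (D.bu W.A D.uI))
    (one (D.bu W.A D.uI)) (by simp) (by simp)
  have h₂ := D.mbu_comp (one W.A) (one W.A)
    (D.mco W.unitCopair (one (D.bu W.A D.uI)))
    (comp (D.mzt W.A (D.bu W.A D.uI) W.A D.uI) (D.mbu (of W.mu) (one (D.bu W.A D.uI))))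
    (by simp) (by simp)
  have h₃ := D.mbu_comp (one W.A) (one W.A) (D.mzt W.A (D.bu W.A D.uI) W.A D.uI)
    (D.mbu (of W.mu) (one (D.bu W.A D.uI))) (by simp) (by simp)
  have h₄ := D.mbu_comp (one W.A) (one W.A) (D.mco (of D.dlI) (one (D.bu W.A D.uI)))
    (D.mco (D.mbu (comp (of W.eta) (of W.dl)) (one D.uI)) (one (D.bu W.A D.uI)))
    (by simp) (by simp)
  simp at h₁ h₂ h₃ h₄
  rw [unitCopair_comul, mulCopairL, h₂, h₃]
  nth_rw 2 [unitCopair]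
  rw [h₁, h₄, unitCopair]
  simp [of_comp, D.of_coh, D.of_buh, D.of_zt, of_id, of_eqToHom] at h
  simp [h]

lemma actCopairL_comp (f g : Mor M) (hf : f.dom = D.bu W.A D.uI) (hg : g.dom = D.co W.A W.A) :
    comp (D.mco W.unitCopair (one (D.bu W.A D.uI)))
        (comp (D.mzt W.A (D.bu W.A D.uI) W.A D.uI) (D.mbu g f))
      = comp (D.mco (comp W.unitCopair (D.mbu (one W.A) f)) (one (D.bu W.A D.uI)))
        (comp (D.mzt W.A f.cod W.A D.uI) (D.mbu g (one f.cod))) := by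
  have h₁ := D.comp_mzt_nat W.unitCopair (one (D.bu W.A D.uI)) (one W.A) f (one W.A) (one D.uI)
    (by simp [hf]) (by simp)
  have h₂ := D.mbu_comp (one (D.co W.A W.A)) g f (one f.cod) (by simp [hg]) (by simp)
  simp [hf, hg] at h₁ h₂
  rw [← comp_assoc (D.mco (comp _ _) _) _ _ (by simp [hf]) (by simp [hg]), h₁, h₂]
  simp [hf, hg]

lemma actCopairR_comp (f g : Mor M) (hf : f.dom = D.bu W.A D.uI) (hg : g.dom = D.co W.A W.A) :
    comp (D.mco (one (D.bu W.A D.uI)) W.unitCopair)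
        (comp (D.mzt W.A D.uI W.A (D.bu W.A D.uI)) (D.mbu g f))
      = comp (D.mco (one (D.bu W.A D.uI)) (comp W.unitCopair (D.mbu (one W.A) f)))
        (comp (D.mzt W.A D.uI W.A f.cod) (D.mbu g (one f.cod))) := by
  have h₁ := D.comp_mzt_nat (one (D.bu W.A D.uI)) W.unitCopair (one W.A) (one D.uI) (one W.A) f
    (by simp) (by simp [hf])
  have h₂ := D.mbu_comp (one (D.co W.A W.A)) g f (one f.cod) (by simp [hg]) (by simp)
  simp [hf, hg] at h₁ h₂
  rw [← comp_assoc (D.mco _ (comp _ _)) _ _ (by simp [hf]) (by simp [hg]), h₁, h₂]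
  simp [hf, hg]

/-- The bundled idempotent `⊓^L_•`. -/
def idemL : Mor M := of W.sqcapLbu

@[simp] lemma idemL_dom : W.idemL.dom = D.bu W.A D.uI := (rfl)

@[simp] lemma idemL_cod : W.idemL.cod = D.bu W.A D.uI := (rfl)

lemma idemL_comp (f : Mor M) (hf : f.dom = D.bu W.A D.uI) :
    comp W.idemL f
      = comp (D.mco (comp W.unitCopair (D.mbu (one W.A) f)) (one (D.bu W.A D.uI)))
        (comp (D.mzt W.A f.cod W.A D.uI)
          (D.mbu (comp (of W.mu) (of W.ep)) (one f.cod))) := by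
  have h := D.mbu_comp (comp (of W.mu) (of W.ep)) (one D.uJ) (one (D.bu W.A D.uI)) f
    (by simp) (by simp [hf])
  simp [hf] at h
  rw [← W.actCopairL_comp f _ hf (by simp), idemL, of_sqcapLbu]
  simp [hf, h]

lemma mulCopairR_comp (f : Mor M) (hf : f.dom = D.bu W.A D.uI) :
    comp W.mulCopairR (D.mbu (one W.A) f)
      = comp (D.mco (one (D.bu W.A D.uI)) (comp W.unitCopair (D.mbu (one W.A) f)))
        (comp (D.mzt W.A D.uI W.A f.cod) (D.mbu (of W.mu) (one f.cod))) := by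
  have h := D.mbu_comp (of W.mu) (one W.A) (one (D.bu W.A D.uI)) f
    (by simp) (by simp [hf])
  simp [hf] at h
  rw [← W.actCopairR_comp f _ hf (by simp), mulCopairR]
  simp [hf, h]

lemma idemL_eq : W.idemL
    = comp W.mulCopairL (D.mbu (of W.ep) (one (D.bu W.A D.uI))) := by
  have h := D.mbu_comp (of W.mu) (of W.ep) (one (D.bu W.A D.uI)) (one (D.bu W.A D.uI))
    (by simp) (by simp)
  simp at h
  rw [idemL, of_sqcapLbu, mulCopairL]
  simp [h]

lemma idemL_comp_comul : comp W.idemL (D.mbu (of W.dl) (one D.uI))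
    = comp W.idemL W.mulCopairR := by
  rw [W.idemL_comp _ (by simp), W.idemL_comp _ (by simp), unitCopair_mulCopairR]
  simp

lemma unitCopair_idemL (hllu : D.LLUeq W.A W.mu W.eta W.dl) :
    comp W.unitCopair (D.mbu (one W.A) W.idemL) = W.unitCopair := by
  have h₁ := D.mbu_comp (one W.A) (one W.A) W.mulCopairL
    (D.mbu (of W.ep) (one (D.bu W.A D.uI))) (by simp) (by simp)
  have h₂ := D.mbu_comp (one W.A) (one W.A) (D.mbu (of W.dl) (one D.uI))
    (D.mbu (of W.ep) (one (D.bu W.A D.uI))) (by simp) (by simp)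
  have h₃ := D.mbu_comp (of W.dl) (D.mbu (of W.ep) (one W.A)) (one D.uI) (one D.uI)
    (by simp) (by simp)
  simp [W.comul_counitL] at h₁ h₂ h₃
  rw [idemL_eq, h₁, ← comp_assoc _ _ _ (by simp) (by simp), W.unitCopair_mulCopairL hllu,
    comp_assoc _ _ _ (by simp) (by simp), ← h₂, ← h₃]
  simp

lemma mulCopairR_idemL (hllu : D.LLUeq W.A W.mu W.eta W.dl) :
    comp W.mulCopairR (D.mbu (one W.A) W.idemL) = W.mulCopairR := by
  rw [W.mulCopairR_comp _ rfl, W.unitCopair_idemL hllu, idemL_cod, mulCopairR]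

section Splitting

variable (i p : Mor M) (hi : i.cod = D.bu W.A D.uI) (hp : p.dom = D.bu W.A D.uI)
  (hc : p.cod = i.dom) (hpi : comp p i = W.idemL) (hip : comp i W.idemL = i)

include hi hip in
lemma comp_comul_eq :
    comp i (D.mbu (of W.dl) (one D.uI)) = comp i W.mulCopairR := by
  rw [← hip, comp_assoc _ _ _ (by simp [hi]) (by simp), idemL_comp_comul,
    ← comp_assoc _ _ _ (by simp [hi]) (by simp)]

include hi hip in
lemma comp_comul_idemL (hllu : D.LLUeq W.A W.mu W.eta W.dl) :
    comp i (comp (D.mbu (of W.dl) (one D.uI)) (D.mbu (one W.A) W.idemL))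
      = comp i (D.mbu (of W.dl) (one D.uI)) := by
  rw [← comp_assoc _ _ _ (by simp [hi]) (by simp), W.comp_comul_eq i hi hip,
    comp_assoc _ _ _ (by simp [hi]) (by simp), W.mulCopairR_idemL hllu]

lemma counitAI_comul : comp W.counitAI (of W.dl)
    = comp (D.mbu (of W.dl) (one D.uI)) (D.mbu (one W.A) W.counitAI) := by
  have h₁ := D.mbu_comp (one W.A) (of W.dl) (of D.tau) (one D.uJ) (by simp) (by simp)
  have h₂ := D.mbu_comp (of W.dl) (one (D.bu W.A W.A)) (one D.uI) (of D.tau) (by simp) (by simp)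
  simp at h₁ h₂
  simp [counitAI, ← h₁, ← h₂]

include hi hip in
lemma comp_counitAI_comul : comp i (comp W.counitAI (of W.dl))
    = comp i (comp (D.mco (one (D.bu W.A D.uI)) (comp (of W.eta) (of W.dl)))
        (comp (D.mzt W.A D.uI W.A W.A) (D.mbu (of W.mu) (one W.A)))) := by
  have h := W.mulCopairR_comp W.counitAI (by simp)
  simp [W.unitCopair_comp_counitAI] at h
  rw [counitAI_comul, ← h, ← comp_assoc _ _ _ (by simp [hi]) (by simp),
    W.comp_comul_eq i hi hip, comp_assoc _ _ _ (by simp [hi]) (by simp)]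

include hi hip in
lemma mco_counitAI_mul_comul :
    comp (D.mco (comp i W.counitAI) (comp i W.counitAI)) (comp (of W.mu) (of W.dl))
      = comp (D.mco i (comp i (comp W.counitAI (of W.dl))))
          (comp (D.mzt W.A D.uI W.A W.A) (D.mbu (of W.mu) (one W.A))) := by
  have h₁ := D.mco_comp (comp i W.counitAI) (of W.dl) (comp i W.counitAI) (of W.dl)
    (by simp [hi]) (by simp [hi])
  have h₂ := D.comp_mzt_nat
    (comp i (comp (D.mco (one (D.bu W.A D.uI)) (comp (of W.eta) (of W.dl)))
      (D.mzt W.A D.uI W.A W.A)))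
    (comp i (comp W.counitAI (of W.dl))) (of W.mu) (one W.A) (one W.A) (one W.A)
    (by simp [hi]) (by simp [hi])
  rw [comp_assoc i _ _ (by simp [hi]) (by simp), comp_assoc _ (D.mzt _ _ _ _) _ (by simp)
    (by simp)] at h₂
  have h₃ := D.mbu_comp (D.mco (of W.mu) (one W.A)) (of W.mu) (one (D.co W.A W.A)) (of W.mu)
    (by simp) (by simp)
  have h₄ := D.mbu_comp (D.mco (one W.A) (of W.mu)) (of W.mu) (of W.mu) (one W.A)
    (by simp) (by simp)
  have h₅ := D.mzt_nat (one W.A) (one D.uI) (of W.mu) (of W.mu)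
  have h₆ := D.mco_comp
    (comp i (D.mco (one (D.bu W.A D.uI)) (comp (of W.eta) (of W.dl)))) (D.mzt W.A D.uI W.A W.A)
    (comp i (comp W.counitAI (of W.dl))) (one (D.bu W.A W.A)) (by simp [hi]) (by simp [hi])
  have h₇ := D.mzt_assoc W.A D.uI W.A W.A W.A W.A
  have h₈ := D.mco_comp i (D.mco (one (D.bu W.A D.uI)) (comp (of W.eta) (of W.dl)))
    (comp i W.counitAI) (of W.dl) (by simp [hi]) (by simp [hi])
  have h₉ := D.mco_comp (one (D.bu W.A D.uI)) (one (D.bu W.A D.uI)) (D.mzt W.A W.A W.A W.A)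
    (D.mbu (of W.mu) (of W.mu)) (by simp) (by simp)
  have h₁₀ := D.mco_comp (one (D.bu W.A D.uI)) (one (D.bu W.A D.uI))
    (D.mco (comp (of W.eta) (of W.dl)) (of W.dl))
    (comp (D.mzt W.A W.A W.A W.A) (D.mbu (of W.mu) (of W.mu))) (by simp) (by simp)
  have h₁₁ := D.mco_comp i (one (D.bu W.A D.uI)) (comp i W.counitAI) (of W.dl)
    (by simp [hi]) (by simp [hi])
  simp [hi] at h₁ h₂ h₃ h₄ h₅ h₆ h₇ h₈ h₉ h₁₀ h₁₁
  rw [mul_comul, ← comp_assoc _ _ _ (by simp [hi]) (by simp), ← h₁]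
  nth_rw 1 [W.comp_counitAI_comul i hi hip]
  rw [← comp_assoc (D.mco (comp i (comp _ _)) _) _ _ (by simp [hi]) (by simp), h₂,
    comp_assoc _ _ _ (by simp [hi]) (by simp), comp_assoc _ _ _ (by simp) (by simp),
    ← h₃, mul_assoc, h₄, h₆, comp_assoc _ _ _ (by simp [hi]) (by simp),
    ← comp_assoc (D.mco (D.mzt _ _ _ _) _) _ _ (by simp) (by simp), h₇,
    comp_assoc _ _ _ (by simp) (by simp),
    ← comp_assoc (D.mzt _ _ _ _) _ _ (by simp) (by simp), ← h₅,
    comp_assoc _ _ _ (by simp) (by simp), h₈, comp_assoc _ _ _ (by simp [hi]) (by simp),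
    ← comp_assoc (D.mco (one _) (D.mzt _ _ _ _)) _ _ (by simp) (by simp), ← h₉,
    ← comp_assoc (D.mco (one _) (D.mco _ _)) _ _ (by simp) (by simp), ← h₁₀,
    mco_unit_comul, ← comp_assoc _ _ _ (by simp [hi]) (by simp), ← h₁₁]

include hi hp hc hpi hip in
lemma comp_comul_retract (hllu : D.LLUeq W.A W.mu W.eta W.dl) (f : Mor M)
    (hf : f.dom = D.bu W.A D.uI) :
    comp (comp i (comp (D.mbu (of W.dl) (one D.uI)) (D.mbu (one W.A) p)))
        (D.mbu (one W.A) (comp i f))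
      = comp i (comp (D.mbu (of W.dl) (one D.uI)) (D.mbu (one W.A) f)) := by
  have h₁ := D.mbu_comp (one W.A) (one W.A) p (comp i f) (by simp) (by simp [hc])
  have h₂ := D.mbu_comp (one W.A) (one W.A) W.idemL f (by simp) (by simp [hf])
  have h₃ := W.comp_comul_idemL i hi hip hllu
  rw [← comp_assoc p i f hc (by simp [hi, hf]), hpi, h₂] at h₁
  rw [comp_assoc _ _ _ (by simp [hi]) (by simp [hp, hc]),
    comp_assoc _ _ _ (by simp [hp]) (by simp [hc]), ← h₁,
    ← comp_assoc _ (D.mbu _ W.idemL) _ (by simp) (by simp [hf]),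
    ← comp_assoc i _ _ (by simp [hi]) (by simp [hf]), h₃,
    comp_assoc _ _ _ (by simp [hi]) (by simp [hf])]

include hi hp hc hpi hip in
lemma mulL_comp_counitAI (hllu : D.LLUeq W.A W.mu W.eta W.dl) :
    comp (D.mco (comp i (comp (D.mbu (of W.dl) (one D.uI)) (D.mbu (one W.A) p)))
        (comp i (comp (D.mbu (of W.dl) (one D.uI)) (D.mbu (one W.A) p))))
      (comp (D.mzt W.A i.dom W.A i.dom)
        (comp (D.mbu (comp (of W.mu) (of W.ep)) (one (D.co i.dom i.dom)))
          (comp (D.mco i (one i.dom)) (comp (D.mco (D.mbu (of W.ep) (one D.uI)) (one i.dom))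
            (comp i W.counitAI)))))
    = comp (D.mco i (comp i (comp W.counitAI (of W.dl))))
        (comp (D.mzt W.A D.uI W.A W.A)
          (D.mbu (comp (of W.mu) (of W.ep)) (one W.A))) := by
  have h₁ := D.mco_comp i (D.mbu (of W.ep) (one D.uI)) (one i.dom) (one i.dom)
    (by simp [hi]) (by simp)
  have h₂ := D.mco_comp (comp i (D.mbu (of W.ep) (one D.uI))) (one D.uI) (one i.dom)
    (comp i W.counitAI) (by simp [hi]) (by simp)
  have h₃ := D.mbu_comp (comp (of W.mu) (of W.ep)) (one D.uJ) (one (D.co i.dom i.dom))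
    (D.mco (comp i (D.mbu (of W.ep) (one D.uI))) (comp i W.counitAI)) (by simp) (by simp)
  have h₄ := D.mbu_comp (one (D.co W.A W.A)) (comp (of W.mu) (of W.ep))
    (D.mco (comp i (D.mbu (of W.ep) (one D.uI))) (comp i W.counitAI)) (one W.A)
    (by simp) (by simp [hi])
  have h₅ := D.mzt_nat (one W.A) (comp i (D.mbu (of W.ep) (one D.uI))) (one W.A)
    (comp i W.counitAI)
  have h₆ := D.mco_comp (comp i (comp (D.mbu (of W.dl) (one D.uI)) (D.mbu (one W.A) p)))
    (D.mbu (one W.A) (comp i (D.mbu (of W.ep) (one D.uI))))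
    (comp i (comp (D.mbu (of W.dl) (one D.uI)) (D.mbu (one W.A) p)))
    (D.mbu (one W.A) (comp i W.counitAI)) (by simp [hi, hp, hc]) (by simp [hi, hp, hc])
  have h₇ := D.mbu_comp (of W.dl) (D.mbu (one W.A) (of W.ep)) (one D.uI) (one D.uI)
    (by simp) (by simp)
  simp [hi] at h₁ h₂ h₃ h₄ h₅
  simp [W.comul_counitR] at h₇
  rw [W.comp_comul_retract i p hi hp hc hpi hip hllu _ (by simp),
    W.comp_comul_retract i p hi hp hc hpi hip hllu _ (by simp), ← counitAI_comul, ← h₇,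
    comp_one _ _ hi] at h₆
  rw [← comp_assoc (D.mco i _) _ _ (by simp [hi]) (by simp), ← h₁, ← h₂,
    ← h₃, h₄, ← comp_assoc (D.mzt _ _ _ _) _ _ (by simp) (by simp [hi]), ← h₅,
    comp_assoc _ _ _ (by simp [hi]) (by simp),
    ← comp_assoc _ _ _ (by simp [hi, hp, hc]) (by simp [hi]), ← h₆]

include hi hp hc hpi hip in
lemma mco_counitAI_mul (hllu : D.LLUeq W.A W.mu W.eta W.dl) :
    comp (D.mco (comp i W.counitAI) (comp i W.counitAI)) (of W.mu)
    = comp (D.mco (comp i (comp (D.mbu (of W.dl) (one D.uI)) (D.mbu (one W.A) p)))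
        (comp i (comp (D.mbu (of W.dl) (one D.uI)) (D.mbu (one W.A) p))))
      (comp (D.mzt W.A i.dom W.A i.dom)
        (comp (D.mbu (comp (of W.mu) (of W.ep)) (one (D.co i.dom i.dom)))
          (comp (D.mco i (one i.dom)) (comp (D.mco (D.mbu (of W.ep) (one D.uI)) (one i.dom))
            (comp i W.counitAI))))) := by
  have h := congrArg (fun f => comp f (D.mbu (of W.ep) (one W.A)))
    (W.mco_counitAI_mul_comul i hi hip)
  have h₁ := D.mbu_comp (of W.mu) (of W.ep) (one W.A) (one W.A) (by simp) (by simp)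
  simp [hi, W.comul_counitL, ← h₁] at h
  rw [h, W.mulL_comp_counitAI i p hi hp hc hpi hip hllu]

end Splitting

end RWB

namespace Duo

variable {M : Type u} [Category.{v} M] (D : Duo M) {A L J P : M} {mu : D.co A A ⟶ A}
  {om : L ⟶ A} {pr : D.co A J ⟶ P} {inc : P ⟶ D.co A J} {f : D.co L J ⟶ P}

theorem coh_linear_left {mL : D.co L L ⟶ L} (hmu : D.coh om om ≫ mu = mL ≫ om)
    (hinc : f ≫ inc = D.coh om (𝟙 J)) (hpr : f = D.coh om (𝟙 J) ≫ pr) :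
    D.coh (𝟙 L) f ≫ D.coh om (𝟙 P) ≫ D.coh (𝟙 A) inc ≫ eqToHom (D.coA A A J).symm
        ≫ D.coh mu (𝟙 J) ≫ pr
      = eqToHom (D.coA L L J).symm ≫ D.coh mL (𝟙 J) ≫ f := by
  have h₁ := D.coh_comp (𝟙 L) om f (𝟙 P)
  have h₂ := D.coh_comp om (𝟙 A) f inc
  have h₃ := D.coh_comp mL om (𝟙 J) (𝟙 J)
  have h₄ := D.coh_comp (D.coh om om) mu (𝟙 J) (𝟙 J)
  rw [hmu, h₃, D.coh_assoc] at h₄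
  rw [Category.id_comp, Category.comp_id] at h₁
  rw [hinc, Category.comp_id] at h₂
  rw [← Category.assoc, ← h₁, ← Category.assoc, ← h₂, hpr, ← Category.assoc (D.coh mL _), h₄]
  simp

theorem coh_linear_right {r : D.co J J ⟶ J} (hinc : f ≫ inc = D.coh om (𝟙 J))
    (hpr : f = D.coh om (𝟙 J) ≫ pr) :
    D.coh f (𝟙 J) ≫ D.coh inc (𝟙 J) ≫ eqToHom (D.coA A J J) ≫ D.coh (𝟙 A) r ≫ pr
      = eqToHom (D.coA L J J) ≫ D.coh (𝟙 L) r ≫ f := by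
  have h₁ := D.coh_comp f inc (𝟙 J) (𝟙 J)
  have h₂ := D.coh_assoc om (𝟙 J) (𝟙 J)
  have h₃ := D.coh_comp om (𝟙 A) (𝟙 (D.co J J)) r
  have h₄ := D.coh_comp (𝟙 L) om r (𝟙 J)
  rw [hinc, Category.id_comp, h₂, D.coh_id] at h₁
  rw [Category.comp_id, Category.id_comp] at h₃
  rw [Category.comp_id, Category.id_comp, h₃] at h₄
  rw [← Category.assoc, ← h₁, hpr, ← Category.assoc (D.coh (𝟙 L) r), ← h₄]
  simp

end Duo

namespace RWB

open Mor

variable {M : Type u} [Category.{v} M] {D : Duo M} (W : RWB D)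

attribute [local simp] Duo.coA Duo.coL Duo.coR Duo.buA Duo.buL Duo.buR

/-- The morphism `(A•τ).ι : L ⟶ A` associated to a morphism `ι : L ⟶ A•I`. -/
def omegaL {L : M} (i : L ⟶ W.AI) : L ⟶ W.A :=
  i ≫ D.buh (𝟙 W.A) D.tau ≫ eqToHom (D.buR W.A)

/-- The multiplication of a retract of `⊓^L_•`. -/
def mulL {L : M} (p : W.AI ⟶ L) (i : L ⟶ W.AI) : D.co L L ⟶ L :=
  (D.coh (i ≫ D.buh W.dl (𝟙 D.uI) ≫ eqToHom (D.buA W.A W.A D.uI) ≫ D.buh (𝟙 W.A) p)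
      (i ≫ D.buh W.dl (𝟙 D.uI) ≫ eqToHom (D.buA W.A W.A D.uI) ≫ D.buh (𝟙 W.A) p)
    ≫ D.zt W.A L W.A L ≫ D.buh (W.mu ≫ W.ep) (𝟙 (D.co L L)) ≫ eqToHom (D.buL (D.co L L)))
    ≫ D.coh i (𝟙 L) ≫ D.coh (D.buh W.ep (𝟙 D.uI) ≫ eqToHom (D.buL D.uI)) (𝟙 L)
    ≫ eqToHom (D.coL L)

theorem coh_omegaL_mu (hllu : D.LLUeq W.A W.mu W.eta W.dl) {L : M} (p : W.AI ⟶ L)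
    (i : L ⟶ W.AI) (hpi : p ≫ i = W.sqcapLbu) (hip : i ≫ p = 𝟙 L) :
    D.coh (W.omegaL i) (W.omegaL i) ≫ W.mu = W.mulL p i ≫ W.omegaL i := by
  have hi : i ≫ W.sqcapLbu = i := by
    rw [← hpi, ← Category.assoc, hip, Category.id_comp]
  have h := W.mco_counitAI_mul (of i) (of p) rfl rfl rfl
    (by rw [← of_comp, hpi, idemL]) (by rw [idemL, ← of_comp, hi])
    hllu
  revert i p
  change ∀ (p : D.bu W.A D.uI ⟶ L) (i : L ⟶ D.bu W.A D.uI), _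
  intro p i _ _ _ h
  apply of_injective
  change of (D.coh (i ≫ D.buh (𝟙 W.A) D.tau ≫ eqToHom (D.buR W.A))
    (i ≫ D.buh (𝟙 W.A) D.tau ≫ eqToHom (D.buR W.A)) ≫ W.mu)
    = of (((D.coh (i ≫ D.buh W.dl (𝟙 D.uI) ≫ eqToHom (D.buA W.A W.A D.uI) ≫ D.buh (𝟙 W.A) p)
      (i ≫ D.buh W.dl (𝟙 D.uI) ≫ eqToHom (D.buA W.A W.A D.uI) ≫ D.buh (𝟙 W.A) p)
    ≫ D.zt W.A L W.A L ≫ D.buh (W.mu ≫ W.ep) (𝟙 (D.co L L)) ≫ eqToHom (D.buL (D.co L L)))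
    ≫ D.coh i (𝟙 L) ≫ D.coh (D.buh W.ep (𝟙 D.uI) ≫ eqToHom (D.buL D.uI)) (𝟙 L)
    ≫ eqToHom (D.coL L)) ≫ i ≫ D.buh (𝟙 W.A) D.tau ≫ eqToHom (D.buR W.A))
  simp only [of_comp, D.of_coh, D.of_buh, D.of_zt, of_id, of_eqToHom]
  simp [counitAI] at h ⊢
  rw [comp_assoc _ _ _ (by simp) (by simp), comp_assoc _ _ _ (by simp) (by simp),
    comp_assoc _ _ _ (by simp) (by simp), comp_assoc _ _ _ (by simp) (by simp)]
  exact h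

section Iso

variable {Lo : M} {pLo : W.AJ ⟶ Lo} {iLo : Lo ⟶ W.AJ} (hpiLo : pLo ≫ iLo = W.sqcapLo)
  (hipLo : iLo ≫ pLo = 𝟙 Lo) {L : M} {p : W.AI ⟶ L} {i : L ⟶ W.AI}
  (hpi : p ≫ i = W.sqcapLbu) (hip : i ≫ p = 𝟙 L)

lemma coh_comp_phiL : D.coh i (𝟙 D.uJ) ≫ W.phiL = D.coh (W.omegaL i) (𝟙 D.uJ) := by
  rw [omegaL, phiL]
  exact (D.coh_comp _ _ _ _).symm.trans (by rw [Category.id_comp])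

include hpi hip in
lemma coh_comp_phiL_sqcapLo :
    D.coh i (𝟙 D.uJ) ≫ W.phiL ≫ W.sqcapLo = D.coh i (𝟙 D.uJ) ≫ W.phiL := by
  rw [← W.phiL'_comp_phiL, ← Category.assoc W.phiL, phiL_comp_phiL', ← Category.assoc,
    ← D.coh_comp, ← hpi, ← Category.assoc i, hip, Category.id_comp, Category.id_comp]

include hpiLo hpi hip in
lemma iso_comp_section : (D.coh i (𝟙 D.uJ) ≫ W.phiL ≫ pLo) ≫ iLo
    = D.coh (W.omegaL i) (𝟙 D.uJ) := by
  rw [Category.assoc, Category.assoc, hpiLo, W.coh_comp_phiL_sqcapLo hpi hip, coh_comp_phiL]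

end Iso

end RWB

/-- **Statement 13.**  Let `A` be a weak bimonoid in a duoidal category with split
idempotents, with fixed splittings of `⊓^L_∘` through `L_∘` and of `⊓^L_•` through
`L_•`.  Then (i) `φ.φ′ = ⊓^L_∘` and `φ′.φ = ⊓^L_•∘J`; (ii) hence
`π^L_∘.φ.(ι^L_•∘J) : L_•∘J ⟶ L_∘` is an isomorphism with inverse
`(π^L_•∘J).φ′.ι^L_∘`; (iii) this isomorphism is a morphism of `L_•`-`J` bimodules. -/
theorem L_iso_LbuJ
    {M : Type u} [Category.{v} M] (D : Duo M) (W : WBim D)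
    (hsplit : SplitIdem M)
    (Lo : M) (pLo : W.toRWB.AJ ⟶ Lo) (iLo : Lo ⟶ W.toRWB.AJ)
    (hpiLo : pLo ≫ iLo = W.toRWB.sqcapLo) (hipLo : iLo ≫ pLo = 𝟙 Lo)
    (Lb : M) (pLb : W.toRWB.AI ⟶ Lb) (iLb : Lb ⟶ W.toRWB.AI)
    (hpiLb : pLb ≫ iLb = W.toRWB.sqcapLbu) (hipLb : iLb ≫ pLb = 𝟙 Lb) :
    -- (i)
    (W.toRWB.phiL' ≫ W.toRWB.phiL = W.toRWB.sqcapLo ∧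
      W.toRWB.phiL ≫ W.toRWB.phiL' = D.coh W.toRWB.sqcapLbu (𝟙 D.uJ)) ∧
    -- (ii)  the mutually inverse isomorphisms u, v
    (let u : D.co Lb D.uJ ⟶ Lo := D.coh iLb (𝟙 D.uJ) ≫ W.toRWB.phiL ≫ pLo
     let v : Lo ⟶ D.co Lb D.uJ := iLo ≫ W.toRWB.phiL' ≫ D.coh pLb (𝟙 D.uJ)
     (u ≫ v = 𝟙 (D.co Lb D.uJ) ∧ v ≫ u = 𝟙 Lo) ∧
    -- (iii)  u is a morphism of `L_•`-`J` bimodules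
     (let omega : Lb ⟶ W.A := iLb ≫ D.buh (𝟙 W.A) D.tau ≫ eqToHom (D.buR W.A)
      let cLb : Lb ⟶ D.bu W.A Lb :=
        iLb ≫ D.buh W.dl (𝟙 D.uI) ≫ eqToHom (D.buA W.A W.A D.uI)
          ≫ D.buh (𝟙 W.A) pLb
      let chiLL : D.co Lb Lb ⟶ D.co Lb Lb :=
        D.coh cLb cLb ≫ D.zt W.A Lb W.A Lb
          ≫ D.buh (W.mu ≫ W.ep) (𝟙 (D.co Lb Lb)) ≫ eqToHom (D.buL (D.co Lb Lb))
      let jeps : W.toRWB.AI ⟶ D.uI :=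
        D.buh W.ep (𝟙 D.uI) ≫ eqToHom (D.buL D.uI)
      let muLb : D.co Lb Lb ⟶ Lb :=
        chiLL ≫ D.coh iLb (𝟙 Lb) ≫ D.coh jeps (𝟙 Lb) ≫ eqToHom (D.coL Lb)
      let aLo : D.co W.A Lo ⟶ Lo :=
        D.coh (𝟙 W.A) iLo ≫ eqToHom (D.coA W.A W.A D.uJ).symm
          ≫ D.coh W.mu (𝟙 D.uJ) ≫ pLo
      let jLo : D.co Lo D.uJ ⟶ Lo :=
        D.coh iLo (𝟙 D.uJ) ≫ eqToHom (D.coA W.A D.uJ D.uJ)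
          ≫ D.coh (𝟙 W.A) D.pw ≫ pLo
      -- u is left `L_•`-linear …
      (D.coh (𝟙 Lb) u ≫ D.coh omega (𝟙 Lo) ≫ aLo
          = eqToHom (D.coA Lb Lb D.uJ).symm ≫ D.coh muLb (𝟙 D.uJ) ≫ u) ∧
      -- … and right `J`-linear
      (D.coh u (𝟙 D.uJ) ≫ jLo
          = eqToHom (D.coA Lb D.uJ D.uJ) ≫ D.coh (𝟙 Lb) D.pw ≫ u))) := by
  have hu := W.toRWB.iso_comp_section hpiLo hpiLb hipLb
  have hw : D.coh iLb (𝟙 D.uJ) ≫ W.toRWB.phiL ≫ pLo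
      = D.coh (W.toRWB.omegaL iLb) (𝟙 D.uJ) ≫ pLo := by
    rw [← Category.assoc, RWB.coh_comp_phiL]
    rfl
  have hmu := W.toRWB.coh_omegaL_mu W.llu pLb iLb hpiLb hipLb
  refine ⟨⟨W.toRWB.phiL'_comp_phiL, W.toRWB.phiL_comp_phiL'⟩, ⟨?_, ?_⟩, ?_, ?_⟩
  · rw [← Category.assoc, hu, ← RWB.coh_comp_phiL, Category.assoc,
      ← Category.assoc W.toRWB.phiL, W.toRWB.phiL_comp_phiL', ← D.coh_comp, ← D.coh_comp,
      ← hpiLb]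
    simp [hipLb, D.coh_id]
  · rw [Category.assoc, Category.assoc, ← Category.assoc (D.coh pLb _), ← D.coh_comp, hpiLb,
      Category.comp_id, ← W.toRWB.phiL_comp_phiL', Category.assoc,
      ← Category.assoc W.toRWB.phiL', ← Category.assoc W.toRWB.phiL' W.toRWB.phiL,
      W.toRWB.phiL'_comp_phiL, ← hpiLo]
    simp [hipLo]
  · exact D.coh_linear_left hmu hu hw
  · exact D.coh_linear_right hu hw
end

section
/- Let A be a weak bimonoid in a duoidal category (M,∘,I,•,J). Then ψ_M := ((M∘A)•μ).ζ.((M•A)∘Δ) : (M•A)∘A → (M∘A)•A (natural in M) is a weak mixed distributive law between the monad (−)∘A and the comonad (−)•A on M; explicitly, for every object M: (i) ((M∘μ)•A).ψ_{M∘A}.(ψ_M∘A) = ψ_M.((M•A)∘μ) : (M•A)∘A∘A → (M∘A)•A; (ii) ψ_M.((M•A)∘η) = ((M∘A)•ε•A).(ψ_M•A).(((M•A)∘η)•A).(M•Δ) : M•A → (M∘A)•A; (iii) ((M∘A)•Δ).ψ_M = (ψ_M•A).ψ_{M•A}.((M•Δ)∘A) : (M•A)∘A → (M∘A)•A•A;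 (iv) ((M∘A)•ε).ψ_M = (M∘μ).(((M∘A)•ε)∘A).(ψ_M∘A).((M•A)∘η∘A) : (M•A)∘A → M∘A. -/
open CategoryTheory

universe v u

namespace RWB

variable {M : Type u} [Category.{v} M] {D : Duo M} (W : RWB D)

/-- The morphism `ψ_M := ((M∘A)•μ).ζ.((M•A)∘Δ) : (M•A)∘A ⟶ (M∘A)•A`. -/
def psi (X : M) : D.co (D.bu X W.A) W.A ⟶ D.bu (D.co X W.A) W.A :=
  D.coh (𝟙 (D.bu X W.A)) W.dl
    ≫ D.zt X W.A W.A W.A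
    ≫ D.buh (𝟙 (D.co X W.A)) W.mu

end RWB

namespace Duo

variable {M : Type u} [Category.{v} M] (D : Duo M)

lemma coh_eqToHom {X X' Y Y' : M} (h : X = X') (k : Y = Y') :
    D.coh (eqToHom h) (eqToHom k) = eqToHom (by rw [h, k]) := by
  subst h k
  simp [D.coh_id]

lemma buh_eqToHom {X X' Y Y' : M} (h : X = X') (k : Y = Y') :
    D.buh (eqToHom h) (eqToHom k) = eqToHom (by rw [h, k]) := by
  subst h k
  simp [D.buh_id]

lemma coh_eqToHom_id {X X' : M} (h : X = X') (Y : M) :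
    D.coh (eqToHom h) (𝟙 Y) = eqToHom (by rw [h]) :=
  D.coh_eqToHom h rfl

lemma coh_id_eqToHom (X : M) {Y Y' : M} (h : Y = Y') :
    D.coh (𝟙 X) (eqToHom h) = eqToHom (by rw [h]) :=
  D.coh_eqToHom rfl h

lemma buh_eqToHom_id {X X' : M} (h : X = X') (Y : M) :
    D.buh (eqToHom h) (𝟙 Y) = eqToHom (by rw [h]) :=
  D.buh_eqToHom h rfl

lemma buh_id_eqToHom (X : M) {Y Y' : M} (h : Y = Y') :
    D.buh (𝟙 X) (eqToHom h) = eqToHom (by rw [h]) :=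
  D.buh_eqToHom rfl h

lemma coh_id_comp {X Y₁ Y₂ Y₃ : M} (f : Y₁ ⟶ Y₂) (g : Y₂ ⟶ Y₃) :
    D.coh (𝟙 X) (f ≫ g) = D.coh (𝟙 X) f ≫ D.coh (𝟙 X) g := by
  rw [← D.coh_comp, Category.comp_id]

lemma coh_comp_id {X Y₁ Y₂ Y₃ : M} (f : Y₁ ⟶ Y₂) (g : Y₂ ⟶ Y₃) :
    D.coh (f ≫ g) (𝟙 X) = D.coh f (𝟙 X) ≫ D.coh g (𝟙 X) := by
  rw [← D.coh_comp, Category.comp_id]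

lemma buh_id_comp {X Y₁ Y₂ Y₃ : M} (f : Y₁ ⟶ Y₂) (g : Y₂ ⟶ Y₃) :
    D.buh (𝟙 X) (f ≫ g) = D.buh (𝟙 X) f ≫ D.buh (𝟙 X) g := by
  rw [← D.buh_comp, Category.comp_id]

lemma buh_comp_id {X Y₁ Y₂ Y₃ : M} (f : Y₁ ⟶ Y₂) (g : Y₂ ⟶ Y₃) :
    D.buh (f ≫ g) (𝟙 X) = D.buh f (𝟙 X) ≫ D.buh g (𝟙 X) := by
  rw [← D.buh_comp, Category.comp_id]

lemma coh_exchange {X X' Y Y' : M} (f : X ⟶ X') (g : Y ⟶ Y') :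
    D.coh (𝟙 X) g ≫ D.coh f (𝟙 Y') = D.coh f (𝟙 Y) ≫ D.coh (𝟙 X') g := by
  simp [← D.coh_comp]

lemma buh_exchange {X X' Y Y' : M} (f : X ⟶ X') (g : Y ⟶ Y') :
    D.buh (𝟙 X) g ≫ D.buh f (𝟙 Y') = D.buh f (𝟙 Y) ≫ D.buh (𝟙 X') g := by
  simp [← D.buh_comp]

lemma coh_coA {X₁ Y₁ X₂ Y₂ X₃ Y₃ : M} (f₁ : X₁ ⟶ Y₁) (f₂ : X₂ ⟶ Y₂) (f₃ : X₃ ⟶ Y₃) :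
    D.coh (D.coh f₁ f₂) f₃ ≫ eqToHom (D.coA Y₁ Y₂ Y₃)
      = eqToHom (D.coA X₁ X₂ X₃) ≫ D.coh f₁ (D.coh f₂ f₃) := by
  simp [D.coh_assoc]

lemma buh_buR {X Y : M} (f : X ⟶ Y) :
    D.buh f (𝟙 D.uJ) ≫ eqToHom (D.buR Y) = eqToHom (D.buR X) ≫ f := by
  simp [D.buh_unitR]

lemma coR_inv_coh {X Y : M} (f : X ⟶ Y) :
    eqToHom (D.coR X).symm ≫ D.coh f (𝟙 D.uI) = f ≫ eqToHom (D.coR Y).symm := by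
  simp [D.coh_unitR]

lemma coL_coh {X Y : M} (f : X ⟶ Y) :
    D.coh (𝟙 D.uI) f ≫ eqToHom (D.coL Y) = eqToHom (D.coL X) ≫ f := by
  simp [D.coh_unitL]

lemma buh_id_bu (X Y : M) {Z Z' : M} (f : Z ⟶ Z') :
    D.buh (𝟙 (D.bu X Y)) f = eqToHom (D.buA X Y Z) ≫ D.buh (𝟙 X) (D.buh (𝟙 Y) f)
      ≫ eqToHom (D.buA X Y Z').symm := by
  rw [← D.buh_id, D.buh_assoc]

lemma coh_id_co (X Y : M) {Z Z' : M} (f : Z ⟶ Z') :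
    D.coh (𝟙 (D.co X Y)) f = eqToHom (D.coA X Y Z) ≫ D.coh (𝟙 X) (D.coh (𝟙 Y) f)
      ≫ eqToHom (D.coA X Y Z').symm := by
  rw [← D.coh_id, D.coh_assoc]

/-- The canonical morphism `X = I ∘ X ⟶ J ∘ X`. -/
def tauL (X : M) : X ⟶ D.co D.uJ X :=
  eqToHom (D.coL X).symm ≫ D.coh D.tau (𝟙 X)

lemma tauL_pw {X : M} (f : X ⟶ D.uJ) :
    D.tauL X ≫ D.coh (𝟙 D.uJ) f ≫ D.pw = f := by
  have h := D.pw_unitL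
  rw [tauL, Category.assoc, ← reassoc_of% D.coh_exchange, D.coh_unitL]
  simp [h]

lemma coh_tauL (X Y : M) :
    D.coh (D.tauL X) (𝟙 Y) ≫ eqToHom (D.coA D.uJ X Y) = D.tauL (D.co X Y) := by
  simp [tauL, D.coh_comp_id, D.coh_eqToHom_id, D.coh_coA, D.coh_id]

/-- The canonical morphism `I • X ⟶ J • X = X`. -/
def tauBuL (X : M) : D.bu D.uI X ⟶ X :=
  D.buh D.tau (𝟙 X) ≫ eqToHom (D.buL X)

lemma dlI_tauBuL {X : M} (f : D.uI ⟶ X) :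
    D.dlI ≫ D.buh (𝟙 D.uI) f ≫ D.tauBuL X = f := by
  have h := D.dlI_counitL
  rw [tauBuL, reassoc_of% D.buh_exchange, D.buh_unitL]
  simp [reassoc_of% h]

lemma buh_tauBuL (X Y : M) :
    D.buh (D.tauBuL X) (𝟙 Y) = eqToHom (D.buA D.uI X Y) ≫ D.tauBuL (D.bu X Y) := by
  simp only [tauBuL, D.buh_comp_id, D.buh_eqToHom_id, D.buh_assoc, D.buh_id, Category.assoc,
    eqToHom_trans]

end Duo

namespace RWB

variable {M : Type u} [Category.{v} M] {D : Duo M} (W : RWB D)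

/-- The opmonoidal structure of `(−)∘A` with respect to `•`. -/
def phi (X P : M) : D.co (D.bu X P) W.A ⟶ D.bu (D.co X W.A) (D.co P W.A) :=
  D.coh (𝟙 (D.bu X P)) W.dl ≫ D.zt X P W.A W.A

/-- The multiplication of the monad `(−)∘A`. -/
def monadMul (X : M) : D.co (D.co X W.A) W.A ⟶ D.co X W.A :=
  eqToHom (D.coA X W.A W.A) ≫ D.coh (𝟙 X) W.mu

/-- The counit of the opmonoidal functor `(−)∘A`. -/
def counitJ : D.co D.uJ W.A ⟶ D.uJ :=
  D.coh (𝟙 D.uJ) W.ep ≫ D.pw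

/-- `psi` followed by the counit of the comonad `(−)•A`. -/
def theta (X : M) : D.co (D.bu X W.A) W.A ⟶ D.co X W.A :=
  W.psi X ≫ D.buh (𝟙 (D.co X W.A)) W.ep ≫ eqToHom (D.buR (D.co X W.A))

lemma psi_eq_phi (X : M) : W.psi X = W.phi X W.A ≫ D.buh (𝟙 (D.co X W.A)) W.mu := by
  simp [psi, phi]

lemma theta_eq_phi (X : M) : W.theta X =
    W.phi X W.A ≫ D.buh (𝟙 (D.co X W.A)) (W.mu ≫ W.ep) ≫ eqToHom (D.buR (D.co X W.A)) := by
  simp [theta, psi_eq_phi, D.buh_id_comp]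

lemma phi_naturality {X X' P P' : M} (f : X ⟶ X') (g : P ⟶ P') :
    D.coh (D.buh f g) (𝟙 W.A) ≫ W.phi X' P'
      = W.phi X P ≫ D.buh (D.coh f (𝟙 W.A)) (D.coh g (𝟙 W.A)) := by
  simp only [phi, Category.assoc, ← D.zt_nat, D.buh_id]
  rw [← reassoc_of% D.coh_exchange]

lemma monadMul_naturality {X Y : M} (f : X ⟶ Y) :
    D.coh (D.coh f (𝟙 W.A)) (𝟙 W.A) ≫ W.monadMul Y = W.monadMul X ≫ D.coh f (𝟙 W.A) := by
  simp only [monadMul, Category.assoc, reassoc_of% D.coh_coA, D.coh_id, D.coh_exchange]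

lemma monadMul_mu :
    W.monadMul W.A ≫ W.mu = D.coh W.mu (𝟙 W.A) ≫ W.mu := by
  simp [monadMul, W.mu_assoc]

lemma phi_monadMul (X P : M) :
    D.coh (W.phi X P) (𝟙 W.A) ≫ W.phi (D.co X W.A) (D.co P W.A)
        ≫ D.buh (W.monadMul X) (W.monadMul P)
      = W.monadMul (D.bu X P) ≫ W.phi X P := by
  have h := D.zt_nat (𝟙 X) (𝟙 P) W.mu W.mu
  rw [D.buh_id] at h
  have hw : W.mu ≫ W.dl = _ := W.wb
  simp only [phi, monadMul, D.buh_comp, D.buh_eqToHom, D.coh_comp_id, Category.assoc]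
  rw [← reassoc_of% D.coh_exchange (D.zt X P W.A W.A) W.dl, reassoc_of% D.zt_assoc1]
  simp only [eqToHom_trans_assoc, eqToHom_refl, Category.id_comp, ← h]
  conv_rhs => rw [← reassoc_of% D.coh_id_comp, hw]
  rw [← reassoc_of% D.coh_comp]
  simp only [Category.id_comp, Category.comp_id, reassoc_of% D.coh_coA, D.coh_id_comp,
    Category.assoc]

lemma phi_coassoc (X P Q : M) :
    W.phi (D.bu X P) Q ≫ D.buh (W.phi X P) (𝟙 (D.co Q W.A)) ≫ eqToHom (D.buA _ _ _)
      = D.coh (eqToHom (D.buA X P Q)) (𝟙 W.A) ≫ W.phi X (D.bu P Q)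
        ≫ D.buh (𝟙 (D.co X W.A)) (W.phi P Q) := by
  have h₁ := D.zt_nat (𝟙 (D.bu X P)) (𝟙 Q) W.dl (𝟙 W.A)
  have h₂ := D.zt_nat (𝟙 X) (𝟙 (D.bu P Q)) (𝟙 W.A) W.dl
  have h₃ := D.coh_exchange (eqToHom (D.buA X P Q)) (W.dl ≫ D.buh (𝟙 W.A) W.dl)
  have h₄ : W.dl ≫ D.buh W.dl (𝟙 W.A)
      = (W.dl ≫ D.buh (𝟙 W.A) W.dl) ≫ eqToHom (D.buA W.A W.A W.A).symm := by
    simp [← W.dl_coassoc]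
  simp only [D.buh_id, D.coh_id] at h₁ h₂
  simp only [phi, D.buh_comp_id, D.buh_id_comp, Category.assoc]
  rw [← reassoc_of% h₁, ← reassoc_of% h₂, reassoc_of% D.zt_assoc2,
    ← reassoc_of% D.coh_id_comp, h₄, D.coh_id_comp]
  conv_rhs => rw [← reassoc_of% D.coh_id_comp, ← reassoc_of% h₃]
  simp [D.coh_id_eqToHom, D.coh_eqToHom_id]

lemma phi_counit (X : M) :
    D.coh (eqToHom (D.buR X).symm) (𝟙 W.A) ≫ W.phi X D.uJ
        ≫ D.buh (𝟙 (D.co X W.A)) W.counitJ ≫ eqToHom (D.buR (D.co X W.A))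
      = 𝟙 (D.co X W.A) := by
  have h := D.zt_nat (𝟙 X) (𝟙 D.uJ) (𝟙 W.A) W.ep
  have h₁ := W.dl_counitR
  have h₂ := D.zt_unitD X W.A
  have h₃ := D.coh_eqToHom (D.buR X).symm (D.buR W.A).symm
  rw [← Category.assoc, comp_eqToHom_iff, Category.id_comp] at h₁
  simp only [D.buh_id, D.coh_id] at h
  simp only [phi, counitJ, D.buh_id_comp, Category.assoc]
  rw [← reassoc_of% h, ← reassoc_of% D.coh_id_comp, h₁, ← reassoc_of% D.coh_comp]
  simpa [h₃] using h₂

lemma counitJ_theta :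
    D.coh (D.coh (eqToHom (D.buL W.A).symm) (𝟙 W.A) ≫ W.theta D.uJ) (𝟙 W.A)
        ≫ W.monadMul D.uJ ≫ W.counitJ
      = W.monadMul W.A ≫ W.mu ≫ W.ep := by
  have key : D.coh (D.tauL W.A) (𝟙 W.A) ≫ D.coh (𝟙 (D.co D.uJ W.A)) W.dl
      ≫ D.coh (eqToHom (D.buL _).symm) (𝟙 (D.bu W.A W.A))
      ≫ D.zt D.uJ (D.co D.uJ W.A) W.A W.A
      ≫ D.buh (𝟙 (D.co D.uJ W.A))
        (eqToHom (D.coA D.uJ W.A W.A) ≫ D.coh (𝟙 D.uJ) (W.mu ≫ W.ep) ≫ D.pw)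
      ≫ eqToHom (D.buR _)
      = D.coh (eqToHom (D.buL W.A).symm) (𝟙 W.A) ≫ W.theta D.uJ := by
    have h := D.zt_nat (𝟙 D.uJ) (D.tauL W.A) (𝟙 W.A) (𝟙 W.A)
    have h' : D.tauL W.A ≫ eqToHom (D.buL _).symm
        = eqToHom (D.buL _).symm ≫ D.buh (𝟙 D.uJ) (D.tauL W.A) := by
      simp [D.buh_unitL]
    rw [D.buh_id, D.coh_id] at h
    rw [← reassoc_of% D.coh_exchange, ← reassoc_of% D.coh_comp_id, h', D.coh_comp_id,
      Category.assoc, reassoc_of% h, ← reassoc_of% D.buh_id_comp, reassoc_of% D.coh_tauL,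
      D.tauL_pw, reassoc_of% D.coh_exchange, theta_eq_phi, phi, Category.assoc]
  have h := D.coh (D.coh (D.tauL W.A) (𝟙 W.A)) (𝟙 W.A) ≫= W.llc
  rw [← key]
  simp only [monadMul, counitJ, D.coh_comp_id, D.buh_id_comp, D.coh_id_comp, Category.assoc,
    D.coh_eqToHom_id, eqToHom_trans_assoc, D.buh_id_eqToHom] at h ⊢
  rw [h, reassoc_of% D.coh_coA, D.coh_id, ← reassoc_of% D.coh_exchange, reassoc_of% D.coh_tauL,
    ← reassoc_of% D.coh_id_comp, D.tauL_pw]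

/-- Comultiplying the output of `theta` applies `theta` to the second tensorand. -/
lemma theta_phi (X : M) :
    W.theta X ≫ D.coh (eqToHom (D.buR X).symm) (𝟙 W.A) ≫ W.phi X D.uJ
      = W.phi X W.A ≫ D.buh (𝟙 (D.co X W.A))
          (D.coh (eqToHom (D.buL W.A).symm) (𝟙 W.A) ≫ W.theta D.uJ) := by
  have h := W.phi_coassoc X D.uJ W.A
  have h₁ := W.phi_naturality (eqToHom (D.buR X).symm) (𝟙 W.A)
  have h₂ := W.phi_naturality (𝟙 X) (eqToHom (D.buL W.A).symm)
  have h₃ := D.buh_buR (D.coh (eqToHom (D.buR X).symm) (𝟙 W.A) ≫ W.phi X D.uJ)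
  rw [← Category.assoc, comp_eqToHom_iff, Category.assoc] at h
  rw [D.coh_id] at h₁ h₂
  simp only [theta_eq_phi, Category.assoc]
  rw [← h₃, reassoc_of% D.buh_exchange, D.buh_comp_id, Category.assoc, ← reassoc_of% h₁,
    reassoc_of% h]
  simp only [D.buh_id_bu, D.buh_id_comp, Category.assoc, eqToHom_trans, eqToHom_trans_assoc,
    eqToHom_refl, Category.id_comp]
  rw [← reassoc_of% h₂]
  simp only [D.coh_eqToHom_id, D.buh_eqToHom_id, D.buh_id_eqToHom, eqToHom_trans_assoc]

lemma theta_monadMul (X : M) :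
    D.coh (W.theta X) (𝟙 W.A) ≫ W.monadMul X = W.monadMul (D.bu X W.A) ≫ W.theta X := by
  have h : W.monadMul X = W.monadMul X ≫ D.coh (eqToHom (D.buR X).symm) (𝟙 W.A)
      ≫ W.phi X D.uJ ≫ D.buh (𝟙 (D.co X W.A)) W.counitJ ≫ eqToHom (D.buR (D.co X W.A)) := by
    rw [phi_counit, Category.comp_id]
  rw [h, ← reassoc_of% W.monadMul_naturality, ← reassoc_of% W.phi_monadMul,
    ← reassoc_of% D.coh_comp_id, ← reassoc_of% D.coh_comp_id, Category.assoc,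
    theta_phi, D.coh_comp_id, Category.assoc, reassoc_of% W.phi_naturality, theta_eq_phi W X,
    ← reassoc_of% W.phi_monadMul]
  simp only [← reassoc_of% D.buh_comp, D.coh_id, Category.id_comp, Category.comp_id, counitJ_theta]

/-- The lax monoidal structure of `(−)•A` with respect to `∘`. -/
def rho (X P : M) : D.co (D.bu X W.A) (D.bu P W.A) ⟶ D.bu (D.co X P) W.A :=
  D.zt X W.A P W.A ≫ D.buh (𝟙 (D.co X P)) W.mu

/-- The comultiplication of the comonad `(−)•A`. -/
def comonadDl (X : M) : D.bu X W.A ⟶ D.bu (D.bu X W.A) W.A :=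
  D.buh (𝟙 X) W.dl ≫ eqToHom (D.buA X W.A W.A).symm

/-- The unit of the lax monoidal functor `(−)•A`. -/
def unitI : D.uI ⟶ D.bu D.uI W.A :=
  D.dlI ≫ D.buh (𝟙 D.uI) W.eta

/-- The unit of the monad `(−)∘A`. -/
def monadUnit (X : M) : X ⟶ D.co X W.A :=
  eqToHom (D.coR X).symm ≫ D.coh (𝟙 X) W.eta

/-- `psi` preceded by the unit of the monad `(−)∘A`. -/
def upsilon (X : M) : D.bu X W.A ⟶ D.bu (D.co X W.A) W.A :=
  W.monadUnit (D.bu X W.A) ≫ W.psi X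

lemma psi_eq_rho (X : M) : W.psi X = D.coh (𝟙 (D.bu X W.A)) W.dl ≫ W.rho X W.A := by
  simp [psi, rho]

lemma upsilon_eq_rho (X : M) : W.upsilon X = eqToHom (D.coR (D.bu X W.A)).symm ≫
    D.coh (𝟙 (D.bu X W.A)) (W.eta ≫ W.dl) ≫ W.rho X W.A := by
  simp [upsilon, monadUnit, psi_eq_rho, D.coh_id_comp]

lemma rho_naturality {X X' P P' : M} (f : X ⟶ X') (g : P ⟶ P') :
    D.coh (D.buh f (𝟙 W.A)) (D.buh g (𝟙 W.A)) ≫ W.rho X' P'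
      = W.rho X P ≫ D.buh (D.coh f g) (𝟙 W.A) := by
  simp only [rho, Category.assoc, reassoc_of% D.zt_nat, D.coh_id, D.buh_exchange]

lemma comonadDl_naturality {X Y : M} (f : X ⟶ Y) :
    W.comonadDl X ≫ D.buh (D.buh f (𝟙 W.A)) (𝟙 W.A) = D.buh f (𝟙 W.A) ≫ W.comonadDl Y := by
  simp [comonadDl, D.buh_assoc, D.buh_id, reassoc_of% D.buh_exchange]

lemma dl_comonadDl :
    W.dl ≫ W.comonadDl W.A = W.dl ≫ D.buh W.dl (𝟙 W.A) := by
  simp [comonadDl, ← reassoc_of% W.dl_coassoc]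

lemma comonadDl_counit (X : M) :
    W.comonadDl X ≫ D.buh (D.buh (𝟙 X) W.ep ≫ eqToHom (D.buR X)) (𝟙 W.A)
      = 𝟙 (D.bu X W.A) := by
  have h := W.dl_counitL
  rw [← Category.assoc, comp_eqToHom_iff, Category.id_comp] at h
  simp only [comonadDl, D.buh_comp_id, D.buh_assoc, Category.assoc, eqToHom_trans_assoc,
    eqToHom_refl, Category.id_comp, D.buh_eqToHom_id, eqToHom_trans]
  rw [← reassoc_of% D.buh_id_comp, h]
  simp [D.buh_id_eqToHom]

lemma comonadDl_rho (X P : M) :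
    D.coh (W.comonadDl X) (W.comonadDl P) ≫ W.rho (D.bu X W.A) (D.bu P W.A)
        ≫ D.buh (W.rho X P) (𝟙 W.A)
      = W.rho X P ≫ W.comonadDl (D.co X P) := by
  have h := D.zt_nat (𝟙 X) W.dl (𝟙 P) W.dl
  have hw : W.mu ≫ W.dl = _ := W.wb
  rw [D.coh_id] at h
  simp only [rho, comonadDl, D.coh_comp, D.coh_eqToHom, D.buh_comp_id, Category.assoc]
  rw [reassoc_of% D.buh_exchange (D.zt X W.A P W.A) W.mu, reassoc_of% D.zt_assoc2]
  simp only [eqToHom_trans_assoc, eqToHom_refl, Category.id_comp, reassoc_of% h]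
  conv_rhs => rw [← reassoc_of% D.buh_id_comp, hw]
  simp only [D.buh_id_comp, Category.assoc, D.buh_assoc, D.buh_id_bu, eqToHom_trans_assoc,
    eqToHom_refl, Category.id_comp]
  simp only [← reassoc_of% D.buh_comp, ← D.buh_comp, Category.id_comp, Category.comp_id]

lemma rho_assoc (X P Q : M) :
    D.coh (W.rho X P) (𝟙 (D.bu Q W.A)) ≫ W.rho (D.co X P) Q
        ≫ D.buh (eqToHom (D.coA X P Q)) (𝟙 W.A)
      = eqToHom (D.coA _ _ _) ≫ D.coh (𝟙 (D.bu X W.A)) (W.rho P Q) ≫ W.rho X (D.co P Q) := by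
  have h₁ := D.zt_nat (𝟙 (D.co X P)) W.mu (𝟙 Q) (𝟙 W.A)
  have h₂ := D.zt_nat (𝟙 X) (𝟙 W.A) (𝟙 (D.co P Q)) W.mu
  have h₃ := D.buh_exchange (eqToHom (D.coA X P Q)) (D.coh W.mu (𝟙 W.A) ≫ W.mu)
  simp only [D.buh_id, D.coh_id] at h₁ h₂
  simp only [rho, D.coh_comp_id, D.coh_id_comp, Category.assoc]
  rw [reassoc_of% h₁, reassoc_of% h₂, reassoc_of% D.zt_assoc1,
    ← reassoc_of% D.buh_id_comp, h₃, W.mu_assoc, ← D.buh_id_comp]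
  simp [D.buh_id_comp, D.buh_id_eqToHom, D.buh_eqToHom_id]

lemma rho_unit (X : M) :
    eqToHom (D.coR (D.bu X W.A)).symm ≫ D.coh (𝟙 (D.bu X W.A)) W.unitI ≫ W.rho X D.uI
        ≫ D.buh (eqToHom (D.coR X)) (𝟙 W.A)
      = 𝟙 (D.bu X W.A) := by
  have h := D.zt_nat (𝟙 X) (𝟙 W.A) (𝟙 D.uI) W.eta
  have h₁ := W.mu_unitR
  have h₂ := D.zt_unitB X W.A
  rw [eqToHom_comp_iff, Category.comp_id] at h₁
  simp only [D.buh_id, D.coh_id] at h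
  simp only [rho, unitI, D.coh_id_comp, Category.assoc]
  rw [reassoc_of% h, ← reassoc_of% D.buh_id_comp, h₁]
  simpa [D.buh_id_eqToHom, D.buh_eqToHom_id] using h₂

lemma upsilon_unitI :
    W.unitI ≫ W.comonadDl D.uI
        ≫ D.buh (W.upsilon D.uI ≫ D.buh (eqToHom (D.coL W.A)) (𝟙 W.A)) (𝟙 W.A)
      = W.eta ≫ W.dl ≫ W.comonadDl W.A := by
  have h := W.rru =≫ D.buh (D.buh (D.tauBuL W.A) (𝟙 W.A)) (𝟙 W.A)
  have key : eqToHom (D.coR _).symm ≫ D.coh (𝟙 (D.bu D.uI W.A)) D.dlI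
      ≫ D.coh (𝟙 (D.bu D.uI W.A)) (D.buh (𝟙 D.uI) (W.eta ≫ W.dl))
      ≫ D.coh (𝟙 (D.bu D.uI W.A)) (eqToHom (D.buA D.uI W.A W.A).symm)
      ≫ D.zt D.uI W.A (D.bu D.uI W.A) W.A ≫ D.buh (eqToHom (D.coL _)) (𝟙 (D.co W.A W.A))
      ≫ D.buh (𝟙 (D.bu D.uI W.A)) W.mu
      ≫ D.buh (D.tauBuL W.A) (𝟙 W.A)
      = W.upsilon D.uI ≫ D.buh (eqToHom (D.coL W.A)) (𝟙 W.A) := by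
    have h₁ := D.zt_nat (𝟙 D.uI) (𝟙 W.A) (D.tauBuL W.A) (𝟙 W.A)
    rw [D.buh_id, D.coh_id] at h₁
    rw [D.buh_exchange, ← reassoc_of% D.buh_comp_id, ← D.coL_coh, D.buh_comp_id,
      Category.assoc, ← reassoc_of% h₁, D.buh_tauBuL]
    simp only [← reassoc_of% D.coh_id_comp, eqToHom_trans_assoc, eqToHom_refl, Category.id_comp,
      D.dlI_tauBuL]
    simp only [upsilon_eq_rho, rho, Category.assoc, D.buh_exchange]
  rw [← key]
  simp only [unitI, comonadDl, D.buh_comp_id, D.buh_id_comp, D.coh_id_comp,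
    Category.assoc, D.coh_id_eqToHom, eqToHom_trans_assoc, D.buh_eqToHom_id] at h ⊢
  rw [h, D.buh_assoc, D.buh_id]
  simp only [eqToHom_trans_assoc, eqToHom_refl, Category.id_comp]
  rw [reassoc_of% D.buh_exchange, D.buh_tauBuL]
  simp only [← reassoc_of% D.buh_id_comp, Category.assoc, eqToHom_trans_assoc, eqToHom_refl,
    Category.id_comp, reassoc_of% D.dlI_tauBuL]

/-- Multiplying the second tensorand of the input by `upsilon` applies `upsilon` to the output. -/
lemma rho_upsilon (X : M) :
    W.rho X D.uI ≫ D.buh (eqToHom (D.coR X)) (𝟙 W.A) ≫ W.upsilon X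
      = D.coh (𝟙 (D.bu X W.A)) (W.upsilon D.uI ≫ D.buh (eqToHom (D.coL W.A)) (𝟙 W.A))
        ≫ W.rho X W.A := by
  have h₁ := W.rho_naturality (eqToHom (D.coR X)) (𝟙 W.A)
  have h₂ := W.rho_naturality (𝟙 X) (eqToHom (D.coL W.A))
  have h₃ := D.coR_inv_coh (D.buh (eqToHom (D.coR X)) (𝟙 W.A))
  have h₄ := W.rho_assoc X D.uI W.A
  rw [← eqToHom_comp_iff (D.coA _ _ _).symm] at h₄
  rw [D.buh_id] at h₁ h₂
  simp only [upsilon_eq_rho, D.coh_id_comp, Category.assoc]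
  rw [h₂, ← reassoc_of% h₄, ← reassoc_of% h₃, ← reassoc_of% D.coh_id_comp,
    ← reassoc_of% D.coh_exchange, h₁, ← reassoc_of% D.coR_inv_coh, ← reassoc_of% D.coh_exchange]
  simp only [D.coh_id_co, D.coh_id_comp, D.coh_id_eqToHom, D.coh_eqToHom_id, D.buh_eqToHom_id,
    Category.assoc, eqToHom_trans, eqToHom_trans_assoc]

lemma upsilon_comonadDl (X : M) :
    W.upsilon X ≫ W.comonadDl (D.co X W.A) = W.comonadDl X ≫ D.buh (W.upsilon X) (𝟙 W.A) := by
  symm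
  have h : W.comonadDl X = (eqToHom (D.coR (D.bu X W.A)).symm ≫
      D.coh (𝟙 (D.bu X W.A)) W.unitI ≫ W.rho X D.uI
        ≫ D.buh (eqToHom (D.coR X)) (𝟙 W.A)) ≫ W.comonadDl X := by
    rw [rho_unit, Category.id_comp]
  rw [h]
  simp only [Category.assoc]
  rw [← reassoc_of% W.comonadDl_naturality, ← reassoc_of% W.comonadDl_rho,
    ← D.buh_comp_id, ← D.buh_comp_id, rho_upsilon, D.buh_comp_id, ← reassoc_of% W.rho_naturality,
    upsilon_eq_rho W X]
  simp only [Category.assoc]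
  rw [← W.comonadDl_rho]
  simp only [← reassoc_of% D.coh_comp, D.buh_id, Category.id_comp, Category.comp_id,
    upsilon_unitI, Category.assoc]

lemma psi_naturality {X Y : M} (f : X ⟶ Y) :
    D.coh (D.buh f (𝟙 W.A)) (𝟙 W.A) ≫ W.psi Y = W.psi X ≫ D.buh (D.coh f (𝟙 W.A)) (𝟙 W.A) := by
  rw [psi_eq_phi, psi_eq_phi, reassoc_of% W.phi_naturality, D.coh_id, Category.assoc,
    D.buh_exchange]

lemma psi_mul (X : M) :
    D.coh (W.psi X) (𝟙 W.A) ≫ W.psi (D.co X W.A) ≫ D.buh (W.monadMul X) (𝟙 W.A)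
      = W.monadMul (D.bu X W.A) ≫ W.psi X := by
  simp only [psi_eq_phi, D.coh_comp_id, Category.assoc]
  rw [reassoc_of% W.phi_naturality, ← reassoc_of% W.phi_monadMul]
  simp only [← D.buh_comp, D.coh_id, Category.id_comp, Category.comp_id,
    monadMul_mu]

lemma psi_comul (X : M) :
    W.psi X ≫ W.comonadDl (D.co X W.A)
      = D.coh (W.comonadDl X) (𝟙 W.A) ≫ W.psi (D.bu X W.A) ≫ D.buh (W.psi X) (𝟙 W.A) := by
  have h := W.rho_naturality (𝟙 (D.bu X W.A)) W.dl
  rw [D.buh_id] at h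
  simp only [psi_eq_rho, D.buh_comp_id, Category.assoc]
  rw [← comonadDl_rho, ← reassoc_of% h]
  simp only [← reassoc_of% D.coh_comp, Category.id_comp, Category.comp_id, dl_comonadDl]

lemma monadUnit_monadMul (X : M) :
    D.coh (W.monadUnit X) (𝟙 W.A) ≫ W.monadMul X = 𝟙 (D.co X W.A) := by
  have h := W.mu_unitL
  rw [eqToHom_comp_iff, Category.comp_id] at h
  rw [monadMul, monadUnit, D.coh_comp_id, Category.assoc, reassoc_of% D.coh_coA,
    ← D.coh_id_comp, h]
  simp [D.coh_id_eqToHom, D.coh_eqToHom_id]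

end RWB

/-- **Statement 14.**  For a weak bimonoid `A` in a duoidal category, the natural
transformation `ψ_M := ((M∘A)•μ).ζ.((M•A)∘Δ)` is a weak mixed distributive law
between the monad `(−)∘A` and the comonad `(−)•A`: it is natural in `M` and
satisfies the four compatibility conditions (i)–(iv) with the multiplication, the
unit, the comultiplication and the counit. -/
theorem psi_weak_mixed_distributive_law
    {M : Type u} [Category.{v} M] (D : Duo M) (W : WBim D) :
    -- naturality in M
    (∀ {X Y : M} (f : X ⟶ Y),
      D.coh (D.buh f (𝟙 W.A)) (𝟙 W.A) ≫ W.toRWB.psi Y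
        = W.toRWB.psi X ≫ D.buh (D.coh f (𝟙 W.A)) (𝟙 W.A)) ∧
    -- (i)  compatibility with the multiplication
    (∀ X : M,
      D.coh (W.toRWB.psi X) (𝟙 W.A) ≫ W.toRWB.psi (D.co X W.A)
          ≫ D.buh (eqToHom (D.coA X W.A W.A) ≫ D.coh (𝟙 X) W.mu) (𝟙 W.A)
        = eqToHom (D.coA (D.bu X W.A) W.A W.A) ≫ D.coh (𝟙 (D.bu X W.A)) W.mu
            ≫ W.toRWB.psi X) ∧
    -- (ii)  compatibility with the unit
    (∀ X : M,
      eqToHom (D.coR (D.bu X W.A)).symm ≫ D.coh (𝟙 (D.bu X W.A)) W.eta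
          ≫ W.toRWB.psi X
        = D.buh (𝟙 X) W.dl
            ≫ eqToHom (D.buA X W.A W.A).symm
            ≫ D.buh (eqToHom (D.coR (D.bu X W.A)).symm
                ≫ D.coh (𝟙 (D.bu X W.A)) W.eta) (𝟙 W.A)
            ≫ D.buh (W.toRWB.psi X) (𝟙 W.A)
            ≫ D.buh (D.buh (𝟙 (D.co X W.A)) W.ep ≫ eqToHom (D.buR (D.co X W.A)))
                (𝟙 W.A)) ∧
    -- (iii)  compatibility with the comultiplication
    (∀ X : M,
      W.toRWB.psi X ≫ D.buh (𝟙 (D.co X W.A)) W.dl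
        = D.coh (D.buh (𝟙 X) W.dl ≫ eqToHom (D.buA X W.A W.A).symm) (𝟙 W.A)
            ≫ W.toRWB.psi (D.bu X W.A)
            ≫ D.buh (W.toRWB.psi X) (𝟙 W.A)
            ≫ eqToHom (D.buA (D.co X W.A) W.A W.A)) ∧
    -- (iv)  compatibility with the counit
    (∀ X : M,
      W.toRWB.psi X ≫ D.buh (𝟙 (D.co X W.A)) W.ep ≫ eqToHom (D.buR (D.co X W.A))
        = D.coh (eqToHom (D.coR (D.bu X W.A)).symm
              ≫ D.coh (𝟙 (D.bu X W.A)) W.eta) (𝟙 W.A)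
            ≫ D.coh (W.toRWB.psi X) (𝟙 W.A)
            ≫ D.coh (D.buh (𝟙 (D.co X W.A)) W.ep ≫ eqToHom (D.buR (D.co X W.A)))
                (𝟙 W.A)
            ≫ eqToHom (D.coA X W.A W.A) ≫ D.coh (𝟙 X) W.mu) := by
  refine ⟨W.psi_naturality, fun X => ?_, fun X => ?_, fun X => ?_, fun X => ?_⟩
  · simpa only [RWB.monadMul, Category.assoc] using W.psi_mul X
  · have h : W.upsilon X = W.comonadDl X ≫ D.buh (W.upsilon X) (𝟙 W.A)
        ≫ D.buh (D.buh (𝟙 (D.co X W.A)) W.ep ≫ eqToHom (D.buR (D.co X W.A))) (𝟙 W.A) := by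
      rw [← reassoc_of% W.upsilon_comonadDl, W.comonadDl_counit, Category.comp_id]
    simpa only [RWB.upsilon, RWB.monadUnit, RWB.comonadDl, D.buh_comp_id, Category.assoc] using h
  · have h := W.psi_comul X =≫ eqToHom (D.buA (D.co X W.A) W.A W.A)
    simpa only [RWB.comonadDl, Category.assoc, eqToHom_trans, eqToHom_refl, Category.comp_id]
      using h
  · have h : W.theta X = D.coh (W.monadUnit (D.bu X W.A)) (𝟙 W.A)
        ≫ D.coh (W.theta X) (𝟙 W.A) ≫ W.monadMul X := by
      rw [W.theta_monadMul, reassoc_of% W.monadUnit_monadMul]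
    simpa only [RWB.theta, RWB.monadUnit, RWB.monadMul, D.coh_comp_id, Category.assoc] using h
end
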